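/- arXiv:1705.04609 — 2 statements merged into one kernel-verified Lean document; each statement's English description precedes it below -/
import Mathlib

section
/- Let ℓ ≥ 24 and let τ, κ ≥ 0 be integers. Then there exist integers m, c ≥ 0 with the following property. Let G be a graph such that ω(G) ≤ κ, every induced subgraph H of G with ω(H) < κ has χ(H) ≤ τ, and G admits a multicover of length m of a set C with χ(C) > c. Then G has a hole of length exactly ℓ. -/
open SimpleGraph

variable {V : Type*}

/-- `B` covers `C`: they are disjoint and every vertex of `C` has a neighbour in `B`. -/
def Covers (G : SimpleGraph V) (B C : Set V) : Prop :=
  Disjoint B C ∧ ∀ v ∈ C, ∃ b ∈ B, G.Adj b v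

/-- `(x, N)` is a cover of `C`. -/
def IsCover (G : SimpleGraph V) (x : V) (N C : Set V) : Prop :=
  (∀ u ∈ N, G.Adj x u) ∧ x ∉ C ∧ (∀ u ∈ C, ¬ G.Adj x u) ∧ Covers G N C

/-- `S` is a stable set of `G`. -/
def StableSet (G : SimpleGraph V) (S : Set V) : Prop :=
  ∀ u ∈ S, ∀ v ∈ S, ¬ G.Adj u v

/-- `(N x : x ∈ X)` is a multicover of `C` in `G`. -/
def IsMulticover (G : SimpleGraph V) (X : Finset V) (N : V → Set V) (C : Set V) : Prop :=
  StableSet G ↑X ∧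
  (∀ x ∈ X, IsCover G x (N x) C) ∧
  (∀ x ∈ X, ∀ y ∈ X, x ≠ y → y ∉ N x ∧ ∀ u ∈ N x, ¬ G.Adj y u)

/-- `G[S]` has a proper colouring with `n` colours. -/
def ColorableOn (G : SimpleGraph V) (S : Set V) (n : ℕ) : Prop :=
  ∃ f : V → ℕ, (∀ v ∈ S, f v < n) ∧ ∀ u ∈ S, ∀ v ∈ S, G.Adj u v → f u ≠ f v

theorem colorableOn_iff {G : SimpleGraph V} {S : Set V} {n : ℕ} :
    ColorableOn G S n ↔ (G.induce S).Colorable n := by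
  classical
  constructor
  · rintro ⟨f, hf, hne⟩
    refine ⟨Coloring.mk (fun v : S => (⟨f v, hf v v.2⟩ : Fin n)) ?_⟩
    intro u v huv h
    exact hne u u.2 v v.2 huv (congrArg Fin.val h)
  · rintro ⟨k⟩
    refine ⟨fun v => if h : v ∈ S then (k ⟨v, h⟩).val else 0, ?_, ?_⟩
    · intro v hv
      simp [hv]
    · intro u hu v hv huv h
      simp only [hu, hv, dif_pos] at h
      have h' : (G.induce S).Adj ⟨u, hu⟩ ⟨v, hv⟩ := huv
      exact k.valid h' (Fin.ext h)

theorem not_colorableOn_iff_lt_chromaticNumber {G : SimpleGraph V} {S : Set V} {n : ℕ} :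
    ¬ ColorableOn G S n ↔ (n : ℕ∞) < (G.induce S).chromaticNumber := by
  rw [colorableOn_iff, ← chromaticNumber_le_iff_colorable, not_le]

namespace ColorableOn

variable {G : SimpleGraph V} {S T : Set V} {a b n : ℕ}

theorem mono (h : ColorableOn G T a) (hST : S ⊆ T) (hab : a ≤ b) : ColorableOn G S b := by
  obtain ⟨f, hf, hne⟩ := h
  exact ⟨f, fun v hv => (hf v (hST hv)).trans_le hab,
    fun u hu v hv => hne u (hST hu) v (hST hv)⟩

theorem union (hS : ColorableOn G S a) (hT : ColorableOn G T b) :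
    ColorableOn G (S ∪ T) (a + b) := by
  classical
  obtain ⟨f, hf, hne⟩ := hS
  obtain ⟨g, hg, hne'⟩ := hT
  refine ⟨fun v => if v ∈ S then f v else a + g v, ?_, ?_⟩
  · rintro v (hv | hv)
    · have := hf v hv
      simp only [hv, if_true]
      omega
    · have := hg v hv
      by_cases h : v ∈ S
      · have := hf v h
        simp only [h, if_true]
        omega
      · simp only [h, if_false]
        omega
  · intro u hu v hv huv
    by_cases hu' : u ∈ S <;> by_cases hv' : v ∈ S <;> simp only [hu', hv', if_true, if_false]
    · exact hne u hu' v hv' huv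
    · have := hf u hu'
      omega
    · have := hf v hv'
      omega
    · have := hne' u (hu.resolve_left hu') v (hv.resolve_left hv') huv
      omega

theorem empty : ColorableOn G ∅ n := ⟨fun _ => 0, by simp, by simp⟩

theorem biUnion {ι : Type*} {Z : Finset ι} {F : ι → Set V}
    (h : ∀ i ∈ Z, ColorableOn G (F i) n) : ColorableOn G (⋃ i ∈ Z, F i) (Z.card * n) := by
  classical
  induction Z using Finset.induction_on with
  | empty => simpa using empty
  | insert i Z hi ih =>
    rw [Finset.set_biUnion_insert, Finset.card_insert_of_notMem hi, Nat.succ_mul, Nat.add_comm]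
    exact (h i (Finset.mem_insert_self i Z)).union
      (ih fun j hj => h j (Finset.mem_insert_of_mem hj))

theorem of_fibers {γ : Type*} [Fintype γ] (f : V → γ)
    (h : ∀ k, ColorableOn G {v | v ∈ S ∧ f v = k} n) :
    ColorableOn G S (Fintype.card γ * n) := by
  refine (biUnion (Z := Finset.univ) fun k _ => h k).mono ?_ le_rfl
  intro v hv
  simp [hv]

theorem diff_union_of_not (hS : ¬ ColorableOn G S (a + b)) (hT : ColorableOn G T b) :
    ¬ ColorableOn G (S \ T) a := fun h =>
  hS ((h.union hT).mono (fun v hv => by by_cases hv' : v ∈ T <;> simp [hv, hv']) le_rfl)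

end ColorableOn

theorem exists_refinement {G : SimpleGraph V} {γ : Type*} [Fintype γ] {X : Finset V}
    {N : V → Set V} {C : Set V} {c : ℕ} (f : V → V → γ)
    (cov : ∀ x ∈ X, ∀ v ∈ C, ∃ u ∈ N x, G.Adj u v)
    (hC : ¬ ColorableOn G C (Fintype.card γ ^ X.card * c)) :
    ∃ g : V → γ, ∃ C' ⊆ C, ¬ ColorableOn G C' c ∧
      ∀ x ∈ X, ∀ v ∈ C', ∃ u ∈ N x, f x u = g x ∧ G.Adj u v := by
  classical
  have hex : ∀ x v, ∃ u, x ∈ X → v ∈ C → u ∈ N x ∧ G.Adj u v := by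
    intro x v
    by_cases hx : x ∈ X
    · by_cases hv : v ∈ C
      · obtain ⟨u, hu⟩ := cov x hx v hv
        exact ⟨u, fun _ _ => hu⟩
      · exact ⟨v, fun _ h => absurd h hv⟩
    · exact ⟨v, fun h => absurd h hx⟩
  choose n hn using hex
  have hcard : Fintype.card (X → γ) = Fintype.card γ ^ X.card := by simp
  rw [← hcard] at hC
  obtain ⟨g, hg⟩ := not_forall.1 (mt (ColorableOn.of_fibers
    (fun v => fun x : X => f x (n x v))) hC)
  have hγ : Nonempty V := by
    by_contra h
    rw [not_nonempty_iff] at h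
    exact hg ⟨fun _ => 0, fun v => h.elim v, fun v => h.elim v⟩
  obtain ⟨v₀⟩ := hγ
  refine ⟨fun x => if h : x ∈ X then g ⟨x, h⟩ else f v₀ v₀, _, fun v hv => hv.1, hg, ?_⟩
  rintro x hx v ⟨hv, hvg⟩
  refine ⟨n x v, (hn x v hx hv).1, ?_, (hn x v hx hv).2⟩
  simp only [hx, dif_pos]
  exact congrFun hvg ⟨x, hx⟩

theorem exists_card_eq_subset_fiber {γ : Type*} [DecidableEq γ] {X : Finset V} {t : Finset γ}
    {f : V → γ} {M : ℕ} (hf : ∀ x ∈ X, f x ∈ t) (ht : t.Nonempty) (h : t.card * M ≤ X.card) :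
    ∃ Y ⊆ X, Y.card = M ∧ ∃ k ∈ t, ∀ x ∈ Y, f x = k := by
  obtain ⟨k, hk, hM⟩ := Finset.exists_le_card_fiber_of_mul_le_card_of_maps_to hf ht h
  obtain ⟨Y, hY, hYM⟩ := Finset.exists_subset_card_eq hM
  exact ⟨Y, fun x hx => (Finset.mem_filter.1 (hY hx)).1, hYM, k, hk,
    fun x hx => (Finset.mem_filter.1 (hY hx)).2⟩

theorem exists_large_outdegree_or_independent (R : V → V → Prop) [DecidableRel R] (d : ℕ) :
    ∀ (M : ℕ) (X : Finset V), M * (2 * d + 1) ≤ X.card →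
      (∃ x ∈ X, d ≤ (X.filter (R x)).card) ∨
        ∃ Y ⊆ X, Y.card = M ∧ ∀ x ∈ Y, ∀ y ∈ Y, x ≠ y → ¬ R x y := by
  classical
  intro M
  induction M with
  | zero => exact fun X _ => Or.inr ⟨∅, by simp, by simp, by simp⟩
  | succ M ih =>
    intro X hX
    by_contra! hcon
    obtain ⟨hout, hind⟩ := hcon
    have hne : X.Nonempty := by
      rw [← Finset.card_pos]
      have : 0 < (M + 1) * (2 * d + 1) := by positivity
      omega
    have hin : ∃ x ∈ X, (X.filter (fun z => R z x)).card < d := by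
      by_contra! hall
      have h1 := Finset.sum_card_bipartiteAbove_eq_sum_card_bipartiteBelow (s := X) (t := X) R
      have h2 : ∑ x ∈ X, (X.bipartiteAbove R x).card < ∑ x ∈ X, (X.bipartiteBelow R x).card :=
        Finset.sum_lt_sum_of_nonempty hne fun x hx => (hout x hx).trans_le (hall x hx)
      omega
    obtain ⟨x, hx, hxin⟩ := hin
    have hxout := hout x hx
    set X' := X.filter (fun z => z ≠ x ∧ ¬ R x z ∧ ¬ R z x) with hX'
    have hcov : X ⊆ X' ∪ ({x} ∪ (X.filter (R x) ∪ X.filter (fun z => R z x))) := by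
      intro z hz
      by_cases h1 : z = x <;> by_cases h2 : R x z <;> by_cases h3 : R z x <;>
        simp_all
    have hc1 := Finset.card_le_card hcov
    have hc2 := Finset.card_union_le X' ({x} ∪ (X.filter (R x) ∪ X.filter (fun z => R z x)))
    have hc3 := Finset.card_union_le {x} (X.filter (R x) ∪ X.filter (fun z => R z x))
    have hc4 := Finset.card_union_le (X.filter (R x)) (X.filter (fun z => R z x))
    rw [Finset.card_singleton] at hc3
    have hX'X : X' ⊆ X := Finset.filter_subset _ _
    rcases ih X' (by rw [Nat.succ_mul] at hX; omega) with ⟨z, hz, hzd⟩ | ⟨Y, hY, hYM, hYR⟩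
    · have := hout z (hX'X hz)
      have := Finset.card_le_card (Finset.filter_subset_filter (R z) hX'X)
      omega
    · have hxY : x ∉ Y := fun h => (Finset.mem_filter.1 (hY h)).2.1 rfl
      obtain ⟨u, hu, v, hv, huv, hR⟩ := hind (insert x Y)
        (Finset.insert_subset hx (hY.trans hX'X)) (by rw [Finset.card_insert_of_notMem hxY, hYM])
      rw [Finset.mem_insert] at hu hv
      rcases hu with rfl | hu <;> rcases hv with rfl | hv
      · exact huv rfl
      · exact (Finset.mem_filter.1 (hY hv)).2.2.1 hR
      · exact (Finset.mem_filter.1 (hY hu)).2.2.2 hR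
      · exact hYR u hu v hv huv hR

/-- Every vertex of `C` has a neighbour in `B`. -/
def Dominates (G : SimpleGraph V) (B C : Set V) : Prop := ∀ v ∈ C, ∃ u ∈ B, G.Adj u v

/-- There are no edges between `A` and `B`. -/
def Anticomplete (G : SimpleGraph V) (A B : Set V) : Prop := ∀ u ∈ A, ∀ v ∈ B, ¬ G.Adj u v

theorem Dominates.mono_right {G : SimpleGraph V} {B C C' : Set V} (h : Dominates G B C)
    (hC : C' ⊆ C) : Dominates G B C' := fun v hv => h v (hC hv)

theorem Anticomplete.mono {G : SimpleGraph V} {A A' B B' : Set V} (h : Anticomplete G A B)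
    (hA : A' ⊆ A) (hB : B' ⊆ B) : Anticomplete G A' B' :=
  fun u hu v hv => h u (hA hu) v (hB hv)

theorem exists_split_of_dominates [Finite V] {G : SimpleGraph V} {τ : ℕ}
    (hτ : ∀ v, ColorableOn G (G.neighborSet v) τ) {A C D : Set V} {c : ℕ}
    (hAC : Dominates G A C) (hC : ¬ ColorableOn G C (c + (c + τ)))
    (hD : ¬ ColorableOn G D (c + (c + τ))) :
    ∃ B ⊆ A, ∃ C' ⊆ C, ∃ D' ⊆ D, ¬ ColorableOn G C' c ∧ ¬ ColorableOn G D' c ∧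
      ((Dominates G B C' ∧ Anticomplete G B D') ∨ (Dominates G B D' ∧ Anticomplete G B C')) := by
  classical
  let nb : Set V → Set V := fun B => {v | ∃ u ∈ B, G.Adj u v}
  obtain ⟨B, ⟨hBA, hBc⟩, hmin⟩ := exists_minimal_of_wellFoundedLT
    (fun B : Set V => B ⊆ A ∧ (¬ ColorableOn G (C ∩ nb B) c ∨ ¬ ColorableOn G (D ∩ nb B) c))
    ⟨A, subset_rfl, Or.inl fun h => hC (h.mono (fun v hv => ⟨hv, hAC v hv⟩) (by omega))⟩
  have hne : B.Nonempty := by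
    by_contra h
    rw [Set.not_nonempty_iff_eq_empty] at h
    subst h
    have : nb ∅ = ∅ := by ext; simp [nb]
    rw [this, Set.inter_empty, Set.inter_empty] at hBc
    exact hBc.elim (fun h => h .empty) (fun h => h .empty)
  obtain ⟨y, hy⟩ := hne
  have hsmall : ColorableOn G (C ∩ nb (B \ {y})) c ∧ ColorableOn G (D ∩ nb (B \ {y})) c := by
    by_contra h
    rw [not_and_or] at h
    exact (hmin ⟨Set.sdiff_subset.trans hBA, h⟩ Set.sdiff_subset hy).2 rfl
  have hadd : ∀ E : Set V, ColorableOn G (E ∩ nb (B \ {y})) c →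
      ColorableOn G (nb B ∩ E) (c + τ) := by
    intro E hE
    refine (hE.union (hτ y)).mono ?_ le_rfl
    rintro v ⟨⟨u, hu, huv⟩, hvE⟩
    by_cases h : u = y
    · exact Or.inr (h ▸ huv)
    · exact Or.inl ⟨hvE, u, ⟨hu, h⟩, huv⟩
  have hdiff : ∀ E : Set V, ¬ ColorableOn G E (c + (c + τ)) →
      ColorableOn G (E ∩ nb (B \ {y})) c → ¬ ColorableOn G (E \ nb B) c := by
    intro E hE h hcol
    exact ColorableOn.diff_union_of_not hE (hadd E h)
      (hcol.mono (fun v hv => ⟨hv.1, fun h' => hv.2 ⟨h', hv.1⟩⟩) le_rfl)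
  rcases hBc with h | h
  · exact ⟨B, hBA, C ∩ nb B, Set.inter_subset_left, D \ nb B, Set.sdiff_subset, h,
      hdiff D hD hsmall.2, Or.inl ⟨fun v hv => hv.2, fun u hu v hv huv => hv.2 ⟨u, hu, huv⟩⟩⟩
  · exact ⟨B, hBA, C \ nb B, Set.sdiff_subset, D ∩ nb B, Set.inter_subset_left,
      hdiff C hC hsmall.1, h, Or.inr ⟨fun v hv => hv.2, fun u hu v hv huv => hv.2 ⟨u, hu, huv⟩⟩⟩

theorem exists_two_sided_split (τ n : ℕ) : ∀ c : ℕ, ∃ b : ℕ, ∀ (V : Type) [Finite V]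
    (G : SimpleGraph V), (∀ v, ColorableOn G (G.neighborSet v) τ) →
    ∀ (X : Finset V) (N : V → Set V) (C : Set V), X.card = n →
    (∀ x ∈ X, Dominates G (N x) C) → ¬ ColorableOn G C b →
    ∃ C' ⊆ C, ∃ D' ⊆ C, ¬ ColorableOn G C' c ∧ ¬ ColorableOn G D' c ∧
      ∃ B : V → Set V, ∀ x ∈ X, B x ⊆ N x ∧
        ((Dominates G (B x) C' ∧ Anticomplete G (B x) D') ∨
          (Dominates G (B x) D' ∧ Anticomplete G (B x) C')) := by
  classical
  induction n with
  | zero =>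
    intro c
    refine ⟨c, fun V _ G _ X N C hX _ hC => ⟨C, subset_rfl, C, subset_rfl, hC, hC, N, ?_⟩⟩
    rw [Finset.card_eq_zero] at hX
    simp [hX]
  | succ n ih =>
    intro c
    obtain ⟨b, hb⟩ := ih (c + (c + τ))
    refine ⟨b, fun V _ G hτ X N C hX cov hC => ?_⟩
    obtain ⟨x, X, hx, rfl, hXn⟩ := Finset.card_eq_succ.1 hX
    obtain ⟨C₁, hC₁, D₁, hD₁, hC₁c, hD₁c, B, hB⟩ := hb V G hτ X N C hXn
      (fun z hz => cov z (Finset.mem_insert_of_mem hz)) hC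
    obtain ⟨A, hA, C₂, hC₂, D₂, hD₂, hC₂c, hD₂c, hAs⟩ := exists_split_of_dominates hτ
      ((cov x (Finset.mem_insert_self x X)).mono_right hC₁) hC₁c hD₁c
    refine ⟨C₂, hC₂.trans hC₁, D₂, hD₂.trans hD₁, hC₂c, hD₂c, Function.update B x A, ?_⟩
    intro z hz
    rcases Finset.mem_insert.1 hz with rfl | hz
    · rw [Function.update_self]
      exact ⟨hA, hAs⟩
    · rw [Function.update_of_ne (fun h : z = x => hx (h ▸ hz))]
      refine ⟨(hB z hz).1, (hB z hz).2.imp ?_ ?_⟩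
      · exact fun h => ⟨h.1.mono_right hC₂, h.2.mono subset_rfl hD₂⟩
      · exact fun h => ⟨h.1.mono_right hD₂, h.2.mono subset_rfl hC₂⟩

theorem exists_split (τ M c : ℕ) : ∃ b : ℕ, ∀ (V : Type) [Finite V]
    (G : SimpleGraph V), (∀ v, ColorableOn G (G.neighborSet v) τ) →
    ∀ (X : Finset V) (N : V → Set V) (C : Set V), X.card = 2 * M →
    (∀ x ∈ X, Dominates G (N x) C) → ¬ ColorableOn G C b →
    ∃ Y ⊆ X, Y.card = M ∧ ∃ C' ⊆ C, ∃ D' ⊆ C, ¬ ColorableOn G C' c ∧ ¬ ColorableOn G D' c ∧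
      ∃ B : V → Set V, ∀ x ∈ Y, B x ⊆ N x ∧ Dominates G (B x) C' ∧ Anticomplete G (B x) D' := by
  classical
  obtain ⟨b, hb⟩ := exists_two_sided_split τ (2 * M) c
  refine ⟨b, fun V _ G hτ X N C hX cov hC => ?_⟩
  obtain ⟨C', hC', D', hD', hCc, hDc, B, hB⟩ := hb V G hτ X N C hX cov hC
  obtain ⟨Y, hY, hYM, k, -, hk⟩ := exists_card_eq_subset_fiber (X := X) (M := M)
    (t := (Finset.univ : Finset Bool))
    (f := fun x => decide (Dominates G (B x) C' ∧ Anticomplete G (B x) D'))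
    (fun _ _ => Finset.mem_univ _) ⟨true, Finset.mem_univ _⟩ (by simp [hX])
  cases k with
  | true =>
    exact ⟨Y, hY, hYM, C', hC', D', hD', hCc, hDc, B,
      fun x hx => ⟨(hB x (hY hx)).1, of_decide_eq_true (hk x hx)⟩⟩
  | false =>
    exact ⟨Y, hY, hYM, D', hD', C', hC', hDc, hCc, B,
      fun x hx => ⟨(hB x (hY hx)).1, (hB x (hY hx)).2.resolve_left (of_decide_eq_false (hk x hx))⟩⟩

/-- The clique number is at most `κ`, neighbourhoods are `τ`-colourable, and every set that is not
`τ`-colourable contains a clique of size `κ`. -/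
structure IsCliqueControlled (G : SimpleGraph V) (κ τ : ℕ) : Prop where
  cliqueFree : G.CliqueFree (κ + 1)
  neighborSet_colorableOn : ∀ v, ColorableOn G (G.neighborSet v) τ
  exists_isNClique : ∀ D, ¬ ColorableOn G D τ → ∃ K : Finset V, ↑K ⊆ D ∧ G.IsNClique κ K

/-- The local colourings of neighbourhoods, bundled into one function. -/
theorem exists_neighborSet_coloring {G : SimpleGraph V} {τ : ℕ}
    (hτ : ∀ v, ColorableOn G (G.neighborSet v) τ) :
    ∃ col : V → V → Fin (τ + 1), ∀ v u w, G.Adj v u → G.Adj v w → G.Adj u w →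
      col v u ≠ col v w := by
  choose f hf hne using hτ
  refine ⟨fun v u => Fin.ofNat (τ + 1) (f v u), fun v u w hu hw huw h => ?_⟩
  have h1 := hf v u hu
  have h2 := hf v w hw
  have h' := congrArg Fin.val h
  simp only [Fin.val_ofNat] at h'
  rw [Nat.mod_eq_of_lt (by omega), Nat.mod_eq_of_lt (by omega)] at h'
  exact hne v u hu w hw huw h'

/-- An edge `pq` together with, for every `x ∈ X`, a private neighbour of `p` and one of `q`
in `N x`, those of `p` being pairwise nonadjacent. -/
structure IsGadget (G : SimpleGraph V) (X : Finset V) (N : V → Set V) (p q : V)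
    (y y' : V → V) : Prop where
  adj : G.Adj p q
  mem : ∀ x ∈ X, y x ∈ N x
  mem' : ∀ x ∈ X, y' x ∈ N x
  adj_p : ∀ x ∈ X, G.Adj p (y x)
  not_adj_q : ∀ x ∈ X, ¬ G.Adj q (y x)
  not_adj_p' : ∀ x ∈ X, ¬ G.Adj p (y' x)
  adj_q' : ∀ x ∈ X, G.Adj q (y' x)
  indep : ∀ x ∈ X, ∀ z ∈ X, ¬ G.Adj (y x) (y z)

theorem IsGadget.mono {G : SimpleGraph V} {X X' : Finset V} {N N' : V → Set V} {p q : V}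
    {y y' : V → V} (h : IsGadget G X N p q y y') (hX : X' ⊆ X) (hN : ∀ x ∈ X', N x ⊆ N' x) :
    IsGadget G X' N' p q y y' where
  adj := h.adj
  mem x hx := hN x hx (h.mem x (hX hx))
  mem' x hx := hN x hx (h.mem' x (hX hx))
  adj_p x hx := h.adj_p x (hX hx)
  not_adj_q x hx := h.not_adj_q x (hX hx)
  not_adj_p' x hx := h.not_adj_p' x (hX hx)
  adj_q' x hx := h.adj_q' x (hX hx)
  indep x hx z hz := h.indep x (hX hx) z (hX hz)

theorem IsCliqueControlled.exists_private_neighbors {G : SimpleGraph V} {κ τ : ℕ}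
    (hG : IsCliqueControlled G κ τ) {K : Finset V} (hK : G.IsNClique κ K) (hne : K.Nonempty)
    {A : Set V} (hA : Dominates G A K) :
    ∃ s ∈ K, ∃ k ∈ K, ∃ y ∈ A, ∃ y' ∈ A, G.Adj s k ∧ G.Adj s y ∧ ¬ G.Adj k y ∧
      ¬ G.Adj s y' ∧ G.Adj k y' := by
  classical
  obtain ⟨v, hv⟩ := hne
  obtain ⟨u, hu, huv⟩ := hA v hv
  let tr : V → Finset V := fun y => K.filter (fun k => G.Adj k y)
  obtain ⟨_, ⟨y, ⟨hyA, rfl⟩⟩, hmax⟩ := (K.powerset.finite_toSet.subset (t := tr '' A) (by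
      rintro _ ⟨y, -, rfl⟩
      exact Finset.mem_powerset.2 (Finset.filter_subset _ _))).exists_maximal
    ⟨_, u, hu, rfl⟩
  have hk : ∃ k ∈ K, ¬ G.Adj k y := by
    by_contra! h
    have := hK.insert (a := y) fun b hb => (h b hb).symm
    exact hG.cliqueFree _ this
  obtain ⟨k, hkK, hky⟩ := hk
  obtain ⟨y', hy'A, hy'k⟩ := hA k hkK
  have hs : ∃ s ∈ tr y, s ∉ tr y' := by
    by_contra! h
    have := hmax ⟨y', hy'A, rfl⟩ h (Finset.mem_filter.2 ⟨hkK, hy'k.symm⟩)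
    exact hky (Finset.mem_filter.1 this).2
  obtain ⟨s, hs, hs'⟩ := hs
  obtain ⟨hsK, hsy⟩ := Finset.mem_filter.1 hs
  refine ⟨s, hsK, k, hkK, y, hyA, y', hy'A, ?_, hsy, hky, ?_, hy'k.symm⟩
  · exact hK.1 hsK hkK fun h => hky (h ▸ hsy)
  · exact fun h => hs' (Finset.mem_filter.2 ⟨hsK, h⟩)

theorem IsCliqueControlled.exists_isGadget {G : SimpleGraph V} {κ τ M : ℕ}
    (hG : IsCliqueControlled G κ τ) {X : Finset V} {N : V → Set V} {D : Set V}
    (hN : ∀ x ∈ X, Dominates G (N x) D) (hD : ¬ ColorableOn G D τ)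
    (hM : 0 < M)
    (hX : κ * κ * (τ + 1) * M ≤ X.card) :
    ∃ Y ⊆ X, Y.card = M ∧ ∃ p ∈ D, ∃ q ∈ D, ∃ y y', IsGadget G Y N p q y y' := by
  classical
  obtain ⟨K, hKD, hK⟩ := hG.exists_isNClique D hD
  have hDne : D.Nonempty := by
    by_contra h
    rw [Set.not_nonempty_iff_eq_empty] at h
    exact hD (h ▸ .empty)
  obtain ⟨d, hd⟩ := hDne
  have hKne : K.Nonempty := by
    by_contra h
    rw [Finset.not_nonempty_iff_eq_empty] at h
    subst h
    exact hG.cliqueFree _ (hK.insert (a := d) (by simp))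
  obtain ⟨col, hcol⟩ := exists_neighborSet_coloring hG.neighborSet_colorableOn
  have hex : ∀ x, ∃ s k y y', x ∈ X → s ∈ K ∧ k ∈ K ∧ y ∈ N x ∧ y' ∈ N x ∧ G.Adj s k ∧
      G.Adj s y ∧ ¬ G.Adj k y ∧ ¬ G.Adj s y' ∧ G.Adj k y' := by
    intro x
    by_cases hx : x ∈ X
    · obtain ⟨s, hs, k, hk, y, hy, y', hy', h⟩ :=
        hG.exists_private_neighbors hK hKne ((hN x hx).mono_right hKD)
      exact ⟨s, k, y, y', fun _ => ⟨hs, hk, hy, hy', h⟩⟩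
    · exact ⟨d, d, d, d, fun h => absurd h hx⟩
  choose s k y y' h using hex
  obtain ⟨Y, hYX, hYM, ⟨p, q, i⟩, hpqi, hY⟩ := exists_card_eq_subset_fiber (X := X) (M := M)
    (t := K ×ˢ (K ×ˢ (Finset.univ : Finset (Fin (τ + 1)))))
    (f := fun x => (s x, k x, col (s x) (y x)))
    (fun x hx => by simp [(h x hx).1, (h x hx).2.1])
    (hKne.product (hKne.product ⟨0, Finset.mem_univ _⟩))
    (by simpa [hK.2, mul_assoc] using hX)
  simp only [Finset.mem_product] at hpqi
  simp only [Prod.mk.injEq] at hY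
  refine ⟨Y, hYX, hYM, p, hKD hpqi.1, q, hKD hpqi.2.1, y, y', ?_⟩
  have h' : ∀ x ∈ Y, y x ∈ N x ∧ y' x ∈ N x ∧ G.Adj p q ∧
      G.Adj p (y x) ∧ ¬ G.Adj q (y x) ∧ ¬ G.Adj p (y' x) ∧ G.Adj q (y' x) := by
    intro x hx
    have := (h x (hYX hx)).2.2
    rwa [(hY x hx).1, (hY x hx).2.1] at this
  obtain ⟨x₀, hx₀⟩ := Finset.card_pos.1 (hM.trans_eq hYM.symm)
  refine ⟨(h' x₀ hx₀).2.2.1, fun x hx => (h' x hx).1, fun x hx => (h' x hx).2.1,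
    fun x hx => (h' x hx).2.2.2.1, fun x hx => (h' x hx).2.2.2.2.1,
    fun x hx => (h' x hx).2.2.2.2.2.1, fun x hx => (h' x hx).2.2.2.2.2.2, ?_⟩
  intro x hx z hz hadj
  have h1 := (hY x hx).2.2
  have h2 := (hY z hz).2.2
  rw [(hY x hx).1] at h1
  rw [(hY z hz).1] at h2
  exact hcol p _ _ (h' x hx).2.2.2.1 (h' z hz).2.2.2.1 hadj (h1.trans h2.symm)

/-- The vertices of a gadget. -/
def gadgetVerts (X : Finset V) (p q : V) (y y' : V → V) : Set V :=
  {v | v = p ∨ v = q ∨ ∃ x ∈ X, v = y x ∨ v = y' x}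

theorem gadgetVerts_mono {X Y : Finset V} (h : X ⊆ Y) (p q : V) (y y' : V → V) :
    gadgetVerts X p q y y' ⊆ gadgetVerts Y p q y y' := by
  rintro v (hv | hv | ⟨x, hx, hv⟩)
  exacts [Or.inl hv, Or.inr (Or.inl hv), Or.inr (Or.inr ⟨x, h hx, hv⟩)]

theorem IsGadget.gadgetVerts_subset {G : SimpleGraph V} {X : Finset V} {N : V → Set V} {p q : V}
    {y y' : V → V} (h : IsGadget G X N p q y y') :
    gadgetVerts X p q y y' ⊆ {p, q} ∪ ⋃ x ∈ X, N x := by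
  rintro v (rfl | rfl | ⟨x, hx, rfl | rfl⟩)
  · simp
  · simp
  · exact Or.inr (Set.mem_biUnion hx (h.mem x hx))
  · exact Or.inr (Set.mem_biUnion hx (h.mem' x hx))

/-- A gadget, together with a subfamily `B` of `N` dominating `C` such that the gadget has no
edges to `B` and `C`. -/
structure IsCleanGadget (G : SimpleGraph V) (X : Finset V) (N B : V → Set V) (C : Set V) (p q : V)
    (y y' : V → V) : Prop where
  isGadget : IsGadget G X N p q y y'
  subset : ∀ x ∈ X, B x ⊆ N x
  dominates : ∀ x ∈ X, Dominates G (B x) C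
  anticomplete_right : Anticomplete G (gadgetVerts X p q y y') C
  anticomplete_nbrs : ∀ x ∈ X, Anticomplete G (gadgetVerts X p q y y') (B x)

theorem exists_gadget_and_residue (κ τ M c : ℕ) (hM : 0 < M) : ∃ m b : ℕ, 0 < m ∧
    ∀ (V : Type) [Finite V] (G : SimpleGraph V), IsCliqueControlled G κ τ →
    ∀ (X : Finset V) (N : V → Set V) (C : Set V), X.card = m →
    (∀ x ∈ X, Dominates G (N x) C) → ¬ ColorableOn G C b →
    ∃ Y ⊆ X, Y.card = M ∧ ∃ C' ⊆ C, ¬ ColorableOn G C' c ∧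
      ∃ B : V → Set V, (∀ x ∈ Y, B x ⊆ N x) ∧ (∀ x ∈ Y, Dominates G (B x) C') ∧
      ∃ p ∈ C, ∃ q ∈ C, ∃ y y', IsGadget G Y N p q y y' ∧
        Anticomplete G (gadgetVerts Y p q y y') C' ∧ ∀ x ∈ Y, Anticomplete G {p, q} (B x) := by
  classical
  obtain ⟨b, hb⟩ := exists_split τ (κ * κ * (τ + 1) * M + 1) (c + (2 * M + 2) * τ + τ)
  refine ⟨2 * (κ * κ * (τ + 1) * M + 1), b, by omega, fun V _ G hG X N C hX cov hC => ?_⟩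
  obtain ⟨Y₁, hY₁, hY₁c, C₁, hC₁, D, hD, hC₁c, hDc, B, hB⟩ :=
    hb V G hG.neighborSet_colorableOn X N C hX cov hC
  obtain ⟨Y, hY, hYM, p, hp, q, hq, y, y', hgad⟩ := hG.exists_isGadget (M := M)
    (fun x hx => (cov x (hY₁ hx)).mono_right hD)
    (fun h => hDc (h.mono subset_rfl (Nat.le_add_left _ _))) hM (by omega)
  let Z : Finset V := {p, q} ∪ (Y.image y ∪ Y.image y')
  have hZ : Z.card ≤ 2 * M + 2 := by
    have h1 : Z.card ≤ _ := Finset.card_union_le {p, q} (Y.image y ∪ Y.image y')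
    have h2 := Finset.card_union_le (Y.image y) (Y.image y')
    have h3 : (Y.image y).card ≤ _ := Finset.card_image_le
    have h4 : (Y.image y').card ≤ _ := Finset.card_image_le
    have h5 : ({p, q} : Finset V).card ≤ 2 := Finset.card_le_two
    omega
  have hZcol := (ColorableOn.biUnion (Z := Z) (fun z _ => hG.neighborSet_colorableOn z)).mono
    subset_rfl (Nat.mul_le_mul_right τ hZ)
  refine ⟨Y, hY.trans hY₁, hYM, C₁ \ _, Set.sdiff_subset.trans hC₁,
    ColorableOn.diff_union_of_not (fun h => hC₁c (h.mono subset_rfl (Nat.le_add_right _ _))) hZcol,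
    B, fun x hx => (hB x (hY hx)).1, fun x hx => (hB x (hY hx)).2.1.mono_right Set.sdiff_subset,
    p, hD hp, q, hD hq, y, y', hgad, ?_, ?_⟩
  · intro u hu v hv huv
    refine hv.2 (Set.mem_biUnion (x := u) ?_ huv)
    rcases hu with rfl | rfl | ⟨x, hx, rfl | rfl⟩
    · simp [Z]
    · simp [Z]
    · simp only [Z, Finset.coe_union, Finset.coe_image]
      exact Or.inr (Or.inl ⟨x, hx, rfl⟩)
    · simp only [Z, Finset.coe_union, Finset.coe_image]
      exact Or.inr (Or.inr ⟨x, hx, rfl⟩)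
  · rintro x hx u (rfl | rfl) v hv huv
    · exact (hB x (hY hx)).2.2 v hv _ hp huv.symm
    · exact (hB x (hY hx)).2.2 v hv _ hq huv.symm

theorem exists_homogeneous_refinement {G : SimpleGraph V} {X W : Finset V} {N : V → Set V}
    {C : Set V} {c k : ℕ} (hW : W.card ≤ k) (cov : ∀ x ∈ X, Dominates G (N x) C)
    (hC : ¬ ColorableOn G C ((2 ^ k) ^ X.card * c)) :
    ∃ C' ⊆ C, ¬ ColorableOn G C' c ∧ ∃ B : V → Set V, (∀ x ∈ X, B x ⊆ N x) ∧
      (∀ x ∈ X, Dominates G (B x) C') ∧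
      ∀ w ∈ W, ∀ x ∈ X, (∀ u ∈ B x, G.Adj w u) ∨ ∀ u ∈ B x, ¬ G.Adj w u := by
  classical
  obtain ⟨g, C', hC', hcol, hg⟩ := exists_refinement (X := X) (N := N) (C := C) (c := c)
    (fun _ u => fun w : W => decide (G.Adj w u)) cov (by
      refine fun h => hC (h.mono subset_rfl (Nat.mul_le_mul_right _ (Nat.pow_le_pow_left ?_ _)))
      simpa using Nat.pow_le_pow_right two_pos hW)
  refine ⟨C', hC', hcol, fun x => {u | u ∈ N x ∧ (fun w : W => decide (G.Adj w u)) = g x},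
    fun x _ u hu => hu.1, fun x hx v hv => ?_, fun w hw x _ => ?_⟩
  · obtain ⟨u, hu, hug, huv⟩ := hg x hx v hv
    exact ⟨u, ⟨hu, hug⟩, huv⟩
  · have hval : ∀ u ∈ {u | u ∈ N x ∧ (fun w : W => decide (G.Adj w u)) = g x},
        decide (G.Adj w u) = g x ⟨w, hw⟩ := fun u hu => congrFun hu.2 ⟨w, hw⟩
    cases h : g x ⟨w, hw⟩ with
    | true => exact Or.inl fun u hu => of_decide_eq_true ((hval u hu).trans h)
    | false => exact Or.inr fun u hu => of_decide_eq_false ((hval u hu).trans h)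

theorem exists_stable_refinement {G : SimpleGraph V} {τ : ℕ}
    (hτ : ∀ v, ColorableOn G (G.neighborSet v) τ) {X : Finset V} {N : V → Set V} {C : Set V}
    {m c : ℕ} {w : V} (hw : ∀ x ∈ X, ∀ u ∈ N x, G.Adj w u) (hX : X.card = (τ + 1) * m)
    (cov : ∀ x ∈ X, Dominates G (N x) C)
    (hC : ¬ ColorableOn G C ((τ + 1) ^ X.card * c)) :
    ∃ Y ⊆ X, Y.card = m ∧ ∃ C' ⊆ C, ¬ ColorableOn G C' c ∧ ∃ B : V → Set V,
      (∀ x ∈ Y, B x ⊆ N x) ∧ (∀ x ∈ Y, Dominates G (B x) C') ∧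
      ∀ x ∈ Y, ∀ z ∈ Y, Anticomplete G (B x) (B z) := by
  classical
  obtain ⟨col, hcol⟩ := exists_neighborSet_coloring hτ
  obtain ⟨g, C', hC', hC'c, hg⟩ := exists_refinement (X := X) (N := N) (C := C) (c := c)
    (fun _ u => col w u) cov (by simpa using hC)
  obtain ⟨Y, hY, hYm, k, -, hk⟩ := exists_card_eq_subset_fiber (X := X) (M := m) (f := g)
    (t := Finset.univ) (fun _ _ => Finset.mem_univ _) ⟨0, Finset.mem_univ _⟩ (by simp [hX])
  refine ⟨Y, hY, hYm, C', hC', hC'c, fun x => {u | u ∈ N x ∧ col w u = g x},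
    fun x _ u hu => hu.1, fun x hx v hv => ?_, fun x hx z hz u hu v hv huv => ?_⟩
  · obtain ⟨u, hu, hug, huv⟩ := hg x (hY hx) v hv
    exact ⟨u, ⟨hu, hug⟩, huv⟩
  · refine hcol w u v (hw x (hY hx) u hu.1) (hw z (hY hz) v hv.1) huv ?_
    rw [hu.2, hv.2, hk x hx, hk z hz]

theorem exists_isCleanGadget (κ τ M c : ℕ) (hM : 0 < M) : ∃ m b : ℕ, 0 < m ∧
    ∀ (V : Type) [Finite V] (G : SimpleGraph V), IsCliqueControlled G κ τ →
    ∀ (X : Finset V) (N : V → Set V) (C : Set V), X.card = m →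
    (∀ x ∈ X, Dominates G (N x) C) → (∀ x ∈ X, Anticomplete G (N x) (N x)) →
    ¬ ColorableOn G C b →
    ∃ Y ⊆ X, Y.card = M ∧ ∃ C' ⊆ C, ¬ ColorableOn G C' c ∧
      ∃ B : V → Set V, ∃ p ∈ C, ∃ q ∈ C, ∃ y y', IsCleanGadget G Y N B C' p q y y' := by
  classical
  obtain ⟨m₀, b₀, hm₀, h₀⟩ := exists_gadget_and_residue κ τ M c hM
  set e := (τ + 1) * m₀ with he
  set M₂ := M * (2 * (2 * e) + 1) with hM₂
  set c₃ := c + (τ + 1) ^ e * b₀ with hc₃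
  obtain ⟨m, b, hm, h⟩ := exists_gadget_and_residue κ τ M₂ ((2 ^ (2 * M₂)) ^ M₂ * c₃)
    (by positivity)
  refine ⟨m, b, hm, fun V _ G hG X N C hX cov ind hC => ?_⟩
  obtain ⟨Y₁, hY₁, hY₁c, C₁, hC₁, hC₁c, B₁, hB₁, hdom₁, p, hp, q, hq, y, y', hgad, hantiC, hantiB⟩ :=
    h V G hG X N C hX cov hC
  have hWc : (Y₁.image y ∪ Y₁.image y').card ≤ 2 * M₂ := by
    have h2 := Finset.card_union_le (Y₁.image y) (Y₁.image y')
    have h3 : (Y₁.image y).card ≤ _ := Finset.card_image_le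
    have h4 : (Y₁.image y').card ≤ _ := Finset.card_image_le
    omega
  obtain ⟨C₂, hC₂, hC₂c, B₂, hB₂, hdom₂, hhom⟩ :=
    exists_homogeneous_refinement hWc hdom₁ (by rw [hY₁c]; exact hC₁c)
  have hhom_y : ∀ x ∈ Y₁, ∀ z ∈ Y₁, (∀ u ∈ B₂ z, G.Adj (y x) u) ∨ ∀ u ∈ B₂ z, ¬ G.Adj (y x) u :=
    fun x hx => hhom _ (Finset.mem_union_left _ (Finset.mem_image_of_mem y hx))
  have hhom_y' : ∀ x ∈ Y₁, ∀ z ∈ Y₁,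
      (∀ u ∈ B₂ z, G.Adj (y' x) u) ∨ ∀ u ∈ B₂ z, ¬ G.Adj (y' x) u :=
    fun x hx => hhom _ (Finset.mem_union_right _ (Finset.mem_image_of_mem y' hx))
  rcases exists_large_outdegree_or_independent
    (fun x z => ¬ ∀ u ∈ B₂ z, ¬ G.Adj (y x) u ∧ ¬ G.Adj (y' x) u) (2 * e) M Y₁ hY₁c.ge with
    ⟨x, hx, hdeg⟩ | ⟨Y, hY, hYM, hYR⟩
  · -- one vertex is complete to many of the sets `B₂ z`, whose union can thus be made stable
    obtain ⟨Y₂, hY₂, hY₂c, k, -, hk⟩ := exists_card_eq_subset_fiber (M := e)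
      (t := (Finset.univ : Finset Bool)) (f := fun z => decide (∀ u ∈ B₂ z, G.Adj (y x) u))
      (fun _ _ => Finset.mem_univ _) ⟨true, Finset.mem_univ _⟩
      (by rwa [Finset.card_univ, Fintype.card_bool])
    have hY₂Y₁ : Y₂ ⊆ Y₁ := hY₂.trans (Finset.filter_subset _ _)
    have hw : ∃ w, ∀ z ∈ Y₂, ∀ u ∈ B₂ z, G.Adj w u := by
      cases k with
      | true => exact ⟨y x, fun z hz => of_decide_eq_true (hk z hz)⟩
      | false =>
        refine ⟨y' x, fun z hz => ?_⟩
        have hz₁ := (Finset.mem_filter.1 (hY₂ hz)).2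
        have h1 := (hhom_y x hx z (hY₂Y₁ hz)).resolve_left (of_decide_eq_false (hk z hz))
        exact (hhom_y' x hx z (hY₂Y₁ hz)).resolve_right
          fun h2 => hz₁ fun u hu => ⟨h1 u hu, h2 u hu⟩
    obtain ⟨w, hw⟩ := hw
    obtain ⟨Y₃, hY₃, hY₃c, C₃, hC₃, hC₃c, B₃, hB₃, hdom₃, hstable⟩ :=
      exists_stable_refinement hG.neighborSet_colorableOn (c := b₀) hw hY₂c
        (fun z hz => hdom₂ z (hY₂Y₁ hz))
        (fun h => hC₂c (h.mono subset_rfl (by rw [hY₂c, hc₃]; exact Nat.le_add_left _ _)))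
    obtain ⟨Y, hY, hYM, C₄, hC₄, hC₄c, B₄, hB₄, hdom₄, p, hp, q, hq, y, y', hgad, hantiC, hantiB⟩ :=
      h₀ V G hG Y₃ B₃ C₃ hY₃c hdom₃ hC₃c
    have hC₃C : C₃ ⊆ C := hC₃.trans (hC₂.trans hC₁)
    have hB₃N : ∀ z ∈ Y₃, B₃ z ⊆ N z := fun z hz => (hB₃ z hz).trans
      ((hB₂ z (hY₂Y₁ (hY₃ hz))).trans (hB₁ z (hY₂Y₁ (hY₃ hz))))
    refine ⟨Y, hY.trans (hY₃.trans (hY₂Y₁.trans hY₁)), hYM, C₄, hC₄.trans hC₃C, hC₄c, B₄,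
      p, hC₃C hp, q, hC₃C hq, y, y', hgad.mono subset_rfl fun z hz => hB₃N z (hY hz),
      fun z hz => (hB₄ z hz).trans (hB₃N z (hY hz)), hdom₄, hantiC, fun z hz => ?_⟩
    rintro u (rfl | rfl | ⟨t, ht, rfl | rfl⟩)
    · exact hantiB z hz _ (by simp)
    · exact hantiB z hz _ (by simp)
    · exact fun v hv => hstable t (hY ht) z (hY hz) _ (hgad.mem t ht) v (hB₄ z hz hv)
    · exact fun v hv => hstable t (hY ht) z (hY hz) _ (hgad.mem' t ht) v (hB₄ z hz hv)
  · have hB₂N : ∀ z ∈ Y, B₂ z ⊆ N z := fun z hz => (hB₂ z (hY hz)).trans (hB₁ z (hY hz))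
    refine ⟨Y, hY.trans hY₁, hYM, C₂, hC₂.trans hC₁,
      fun h => hC₂c (h.mono subset_rfl (Nat.le_add_right _ _)), B₂, p, hp, q, hq, y, y',
      hgad.mono hY fun z _ => subset_rfl, hB₂N, fun z hz => hdom₂ z (hY hz),
      hantiC.mono (gadgetVerts_mono hY _ _ _ _) hC₂, fun z hz => ?_⟩
    have hyB : ∀ x ∈ Y, ∀ v ∈ B₂ z, ¬ G.Adj (y x) v ∧ ¬ G.Adj (y' x) v := by
      intro x hx v hv
      by_cases hxz : x = z
      · subst hxz
        exact ⟨ind x (hY₁ (hY hx)) _ (hgad.mem x (hY hx)) v (hB₂N x hx hv),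
          ind x (hY₁ (hY hx)) _ (hgad.mem' x (hY hx)) v (hB₂N x hx hv)⟩
      · exact not_not.1 (hYR x hx z hz hxz) v hv
    rintro u (rfl | rfl | ⟨t, ht, rfl | rfl⟩) v hv
    · exact hantiB z (hY hz) _ (by simp) v (hB₂ z (hY hz) hv)
    · exact hantiB z (hY hz) _ (by simp) v (hB₂ z (hY hz) hv)
    · exact (hyB t ht v hv).1
    · exact (hyB t ht v hv).2

/-- `t` gadgets with vertices in `C` and the sets `N x`, with no edges between distinct ones. -/
structure IsLinkage (G : SimpleGraph V) (X : Finset V) (N : V → Set V) (C : Set V) (t : ℕ)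
    (p q : ℕ → V) (y y' : ℕ → V → V) : Prop where
  isGadget : ∀ i < t, IsGadget G X N (p i) (q i) (y i) (y' i)
  mem_p : ∀ i < t, p i ∈ C
  mem_q : ∀ i < t, q i ∈ C
  anticomplete : ∀ i j, i < j → j < t → Anticomplete G
    (gadgetVerts X (p i) (q i) (y i) (y' i)) (gadgetVerts X (p j) (q j) (y j) (y' j))

theorem exists_isLinkage (κ τ M : ℕ) (hM : 0 < M) (t : ℕ) : ∃ m b : ℕ, 0 < m ∧
    ∀ (V : Type) [Finite V] (G : SimpleGraph V), IsCliqueControlled G κ τ →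
    ∀ (X : Finset V) (N : V → Set V) (C : Set V), X.card = m →
    (∀ x ∈ X, Dominates G (N x) C) → (∀ x ∈ X, Anticomplete G (N x) (N x)) →
    ¬ ColorableOn G C b →
    ∃ Y ⊆ X, Y.card = M ∧ ∃ p q y y', IsLinkage G Y N C t p q y y' := by
  induction t with
  | zero =>
    refine ⟨M, 0, hM, fun V _ G _ X N C hX _ _ hC => ⟨X, subset_rfl, hX, ?_⟩⟩
    obtain ⟨v, -⟩ : C.Nonempty := by
      by_contra h
      rw [Set.not_nonempty_iff_eq_empty] at h
      exact hC (h ▸ .empty)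
    exact ⟨fun _ => v, fun _ => v, fun _ => id, fun _ => id, by simp, by simp, by simp, by simp⟩
  | succ t ih =>
    obtain ⟨m, b, hm, h⟩ := ih
    obtain ⟨m', b', hm', h'⟩ := exists_isCleanGadget κ τ m b hm
    refine ⟨m', b', hm', fun V _ G hG X N C hX cov ind hC => ?_⟩
    obtain ⟨Y, hY, hYm, C', hC', hC'c, B, p₀, hp₀, q₀, hq₀, y₀, y₀', hg⟩ :=
      h' V G hG X N C hX cov ind hC
    obtain ⟨Z, hZ, hZM, p, q, y, y', hl⟩ := h V G hG Y B C' hYm hg.dominates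
      (fun x hx => (ind x (hY hx)).mono (hg.subset x hx) (hg.subset x hx)) hC'c
    refine ⟨Z, hZ.trans hY, hZM, fun i => i.casesOn p₀ p, fun i => i.casesOn q₀ q,
      fun i => i.casesOn y₀ y, fun i => i.casesOn y₀' y', ?_, ?_, ?_, ?_⟩
    · rintro (_ | i) hi
      · exact hg.isGadget.mono hZ fun _ _ => subset_rfl
      · exact (hl.isGadget i (by omega)).mono subset_rfl fun x hx => hg.subset x (hZ hx)
    · rintro (_ | i) hi
      · exact hp₀
      · exact hC' (hl.mem_p i (by omega))
    · rintro (_ | i) hi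
      · exact hq₀
      · exact hC' (hl.mem_q i (by omega))
    · rintro (_ | i) (_ | j) hij hj
      · omega
      · intro u hu v hv
        have hu' := gadgetVerts_mono hZ _ _ _ _ hu
        rcases (hl.isGadget j (by omega)).gadgetVerts_subset hv with (rfl | rfl) | hv
        · exact hg.anticomplete_right u hu' _ (hl.mem_p j (by omega))
        · exact hg.anticomplete_right u hu' _ (hl.mem_q j (by omega))
        · obtain ⟨x, hx, hv⟩ := Set.mem_iUnion₂.1 hv
          exact hg.anticomplete_nbrs x (hZ hx) u hu' v hv
      · omega
      · exact hl.anticomplete i j (by omega) (by omega)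

/-- `f 0, …, f n` are the vertices of an induced path, in order. -/
def IsInducedPath (G : SimpleGraph V) (f : ℕ → V) (n : ℕ) : Prop :=
  ∀ i j, i < j → j ≤ n → (G.Adj (f i) (f j) ↔ j = i + 1)

/-- The sequence following `f` for `n` steps, and then `g`. -/
def appendSeq (f g : ℕ → V) (n : ℕ) (i : ℕ) : V := if i ≤ n then f i else g (i - n)

theorem IsInducedPath.append {G : SimpleGraph V} {f g : ℕ → V} {n m : ℕ}
    (hf : IsInducedPath G f n) (hg : IsInducedPath G g m) (hfg : f n = g 0)
    (h : ∀ i < n, ∀ j, 0 < j → j ≤ m → ¬ G.Adj (f i) (g j)) :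
    IsInducedPath G (appendSeq f g n) (n + m) := by
  intro i j hij hj
  unfold appendSeq
  by_cases hjn : j ≤ n
  · rw [if_pos hjn, if_pos (by omega)]
    exact hf i j hij hjn
  · rw [if_neg hjn]
    rcases lt_trichotomy i n with hin | rfl | hin
    · rw [if_pos hin.le]
      exact iff_of_false (h i hin _ (by omega) (by omega)) (by omega)
    · rw [if_pos le_rfl, hfg, hg 0 (j - i) (by omega) (by omega)]
      omega
    · rw [if_neg (by omega), hg (i - n) (j - n) (by omega) (by omega)]
      omega

theorem nonempty_cycleGraph_embedding {G : SimpleGraph V} {ℓ : ℕ} (hℓ : 5 ≤ ℓ) {h : ℕ → V}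
    (hh : ∀ i j, i < j → j < ℓ → (G.Adj (h i) (h j) ↔ j = i + 1 ∨ i = 0 ∧ j = ℓ - 1)) :
    Nonempty (cycleGraph ℓ ↪g G) := by
  have hadj : ∀ a b : Fin ℓ, G.Adj (h a) (h b) ↔
      b.val = a + 1 ∨ a.val = b + 1 ∨ (a.val = 0 ∧ b.val = ℓ - 1) ∨
        (b.val = 0 ∧ a.val = ℓ - 1) := by
    intro a b
    rcases lt_trichotomy a.val b.val with hab | hab | hab
    · rw [hh a b hab b.2]
      omega
    · rw [hab]
      exact iff_of_false G.irrefl (by omega)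
    · rw [G.adj_comm, hh b a hab a.2]
      omega
  have hcyc : ∀ a b : Fin ℓ, (cycleGraph ℓ).Adj a b ↔
      b.val = a + 1 ∨ a.val = b + 1 ∨ (a.val = 0 ∧ b.val = ℓ - 1) ∨
        (b.val = 0 ∧ a.val = ℓ - 1) := by
    intro a b
    have ha := a.2
    have hb := b.2
    rw [cycleGraph_adj', Fin.val_sub, Fin.val_sub]
    rcases le_or_gt a.val b.val with hab | hab
    · have h2 : (ℓ - a + b.val) = (b.val - a) + ℓ := by omega
      rw [h2, Nat.add_mod_right, Nat.mod_eq_of_lt (a := b.val - a) (by omega)]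
      rcases hab.eq_or_lt with hab | hab
      · rw [hab, Nat.sub_add_cancel hb.le, Nat.mod_self]
        omega
      · rw [Nat.mod_eq_of_lt (by omega)]
        omega
    · have h2 : (ℓ - b + a.val) = (a.val - b) + ℓ := by omega
      rw [h2, Nat.add_mod_right, Nat.mod_eq_of_lt (a := a.val - b) (by omega),
        Nat.mod_eq_of_lt (by omega)]
      omega
  have hne : ∀ a b : Fin ℓ, a < b → h a ≠ h b := by
    intro a b hab heq
    have key : ∀ c : Fin ℓ, G.Adj (h a) (h c) ↔ G.Adj (h b) (h c) := fun c => by rw [heq]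
    have hb := b.2
    rw [Fin.lt_def] at hab
    have h1 := key ⟨a + 1, by omega⟩
    rw [hadj, hadj] at h1
    rcases Nat.eq_zero_or_pos a.val with ha | ha
    · have h2 := key ⟨ℓ - 1, by omega⟩
      rw [hadj, hadj] at h2
      simp only [true_or, true_iff, and_true] at h1 h2
      omega
    · have h2 := key ⟨a - 1, by omega⟩
      rw [hadj, hadj] at h2
      simp only [true_or, true_iff] at h1 h2
      omega
  refine ⟨⟨⟨fun a => h a, fun a b hab => ?_⟩, fun {a b} => (hadj a b).trans (hcyc a b).symm⟩⟩
  rcases lt_trichotomy a b with hlt | heq | hlt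
  exacts [absurd hab (hne a b hlt), heq, absurd hab.symm (hne b a hlt)]

theorem IsInducedPath.nonempty_cycleGraph_embedding {G : SimpleGraph V} {f g : ℕ → V} {n m : ℕ}
    (hf : IsInducedPath G f n) (hg : IsInducedPath G g m) (hfg : f n = g 0) (hgf : g m = f 0)
    (hn : 2 ≤ n) (hm : 2 ≤ m) (hnm : 5 ≤ n + m)
    (h : ∀ i, 0 < i → i < n → ∀ j, 0 < j → j < m → ¬ G.Adj (f i) (g j)) :
    Nonempty (cycleGraph (n + m) ↪g G) := by
  refine _root_.nonempty_cycleGraph_embedding hnm (h := appendSeq f g n) fun i j hij hj => ?_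
  unfold appendSeq
  by_cases hjn : j ≤ n
  · rw [if_pos hjn, if_pos (by omega), hf i j hij hjn]
    omega
  · rw [if_neg hjn]
    rcases lt_trichotomy i n with hin | rfl | hin
    · rw [if_pos hin.le]
      rcases Nat.eq_zero_or_pos i with rfl | hi
      · rw [← hgf, G.adj_comm, hg (j - n) m (by omega) le_rfl]
        omega
      · exact iff_of_false (h i hi hin _ (by omega) (by omega)) (by omega)
    · rw [if_pos le_rfl, hfg, hg 0 (j - i) (by omega) (by omega)]
      omega
    · rw [if_neg (by omega), hg (i - n) (j - n) (by omega) (by omega)]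
      omega

/-- Vertices `x 0, …, x T`, and pairwise anticomplete gadgets with indices below `T` that are
attached to all of them. -/
structure IsGrid (G : SimpleGraph V) (T : ℕ) (x p q : ℕ → V) (y y' : ℕ → ℕ → V) : Prop where
  xx : ∀ i ≤ T, ∀ j ≤ T, ¬ G.Adj (x i) (x j)
  xp : ∀ i ≤ T, ∀ j < T, ¬ G.Adj (x i) (p j)
  xq : ∀ i ≤ T, ∀ j < T, ¬ G.Adj (x i) (q j)
  xy : ∀ i ≤ T, ∀ j < T, ∀ k ≤ T, (G.Adj (x i) (y j k) ↔ i = k)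
  xy' : ∀ i ≤ T, ∀ j < T, ∀ k ≤ T, (G.Adj (x i) (y' j k) ↔ i = k)
  pq : ∀ j < T, G.Adj (p j) (q j)
  py : ∀ j < T, ∀ k ≤ T, G.Adj (p j) (y j k)
  py' : ∀ j < T, ∀ k ≤ T, ¬ G.Adj (p j) (y' j k)
  qy : ∀ j < T, ∀ k ≤ T, ¬ G.Adj (q j) (y j k)
  qy' : ∀ j < T, ∀ k ≤ T, G.Adj (q j) (y' j k)
  yy : ∀ j < T, ∀ k ≤ T, ∀ l ≤ T, ¬ G.Adj (y j k) (y j l)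
  sep : ∀ i j, i < j → j < T → ∀ u v,
    (u = p i ∨ u = q i ∨ ∃ k ≤ T, u = y i k ∨ u = y' i k) →
    (v = p j ∨ v = q j ∨ ∃ k ≤ T, v = y j k ∨ v = y' j k) → ¬ G.Adj u v

/-- The vertices of the `j`-th gadget attached to `x 0, …, x r`. -/
def gridGadget (p q : ℕ → V) (y y' : ℕ → ℕ → V) (j r : ℕ) : Set V :=
  {u | u = p j ∨ u = q j ∨ ∃ k ≤ r, u = y j k ∨ u = y' j k}

/-- There is an induced path of length `L` from `x 0` to `x j`, whose interior consists of other
vertices `x k` with `k < j`, and of vertices of the first `j` gadgets attached to `x 0, …, x j`. -/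
def GridPath (G : SimpleGraph V) (x p q : ℕ → V) (y y' : ℕ → ℕ → V) (j L : ℕ) : Prop :=
  ∃ f : ℕ → V, IsInducedPath G f L ∧ f 0 = x 0 ∧ f L = x j ∧
    ∀ i, 0 < i → i < L → (∃ k, 0 < k ∧ k < j ∧ f i = x k) ∨ ∃ k < j, f i ∈ gridGadget p q y y' k j

theorem gridGadget_mono {p q : ℕ → V} {y y' : ℕ → ℕ → V} {j r s : ℕ} (h : r ≤ s) :
    gridGadget p q y y' j r ⊆ gridGadget p q y y' j s := by
  rintro u (hu | hu | ⟨k, hk, hu⟩)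
  exacts [Or.inl hu, Or.inr (Or.inl hu), Or.inr (Or.inr ⟨k, hk.trans h, hu⟩)]

namespace IsGrid

variable {G : SimpleGraph V} {T : ℕ} {x p q : ℕ → V} {y y' : ℕ → ℕ → V}

theorem not_adj_gridGadget_x (hG : IsGrid G T x p q y y') {k r s : ℕ} (hk : k < T) (hrs : r < s)
    (hs : s ≤ T) {u : V} (hu : u ∈ gridGadget p q y y' k r) : ¬ G.Adj u (x s) := by
  rw [G.adj_comm]
  rcases hu with rfl | rfl | ⟨l, hl, rfl | rfl⟩
  · exact hG.xp s hs k hk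
  · exact hG.xq s hs k hk
  · rw [hG.xy s hs k hk l (by omega)]
    omega
  · rw [hG.xy' s hs k hk l (by omega)]
    omega

theorem not_adj_gridGadget (hG : IsGrid G T x p q y y') {i j r s : ℕ} (hij : i < j) (hj : j < T)
    (hr : r ≤ T) (hs : s ≤ T) {u v : V} (hu : u ∈ gridGadget p q y y' i r)
    (hv : v ∈ gridGadget p q y y' j s) : ¬ G.Adj u v :=
  hG.sep i j hij hj u v (gridGadget_mono hr hu) (gridGadget_mono hs hv)

/-- Extending a path by a link through the next gadget. -/
theorem gridPath_succ (hG : IsGrid G T x p q y y') {j L m : ℕ} (hj : j < T)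
    (h : GridPath G x p q y y' j L) {g : ℕ → V} (hm : 0 < m)
    (hg : IsInducedPath G g m) (hg0 : g 0 = x j) (hgm : g m = x (j + 1))
    (hgi : ∀ i, 0 < i → i < m → g i = p j ∨ g i = q j ∨ g i = y j j ∨ g i = y j (j + 1) ∨
      g i = y' j j ∨ g i = y' j (j + 1))
    (hgx : ∀ i, 0 < i → i ≤ m → ∀ k < j, ¬ G.Adj (x k) (g i)) :
    GridPath G x p q y y' (j + 1) (L + m) := by
  obtain ⟨f, hf, hf0, hfL, hfi⟩ := h
  have hjL : j = 0 → L = 0 := by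
    rintro rfl
    by_contra hL
    rcases Nat.lt_or_ge 1 L with h1 | h1
    · rcases hfi 1 one_pos h1 with ⟨k, -, hk, -⟩ | ⟨k, hk, -⟩ <;> omega
    · obtain rfl : L = 1 := by omega
      have := (hf 0 1 one_pos le_rfl).2 rfl
      rw [hf0, hfL] at this
      exact G.irrefl this
  have hgi' : ∀ i, 0 < i → i < m → g i ∈ gridGadget p q y y' j (j + 1) := by
    intro i hi him
    rcases hgi i hi him with h | h | h | h | h | h
    · exact Or.inl h
    · exact Or.inr (Or.inl h)
    · exact Or.inr (Or.inr ⟨j, by omega, Or.inl h⟩)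
    · exact Or.inr (Or.inr ⟨j + 1, le_rfl, Or.inl h⟩)
    · exact Or.inr (Or.inr ⟨j, by omega, Or.inr h⟩)
    · exact Or.inr (Or.inr ⟨j + 1, le_rfl, Or.inr h⟩)
  refine ⟨appendSeq f g L, hf.append hg (hfL.trans hg0.symm) ?_, ?_, ?_, ?_⟩
  · intro i hi k hk hkm
    have hx : ∀ l < j, f i = x l → ¬ G.Adj (f i) (g k) := fun l hl h => h ▸ hgx k hk hkm l hl
    rcases Nat.eq_zero_or_pos i with rfl | hi0
    · exact hx 0 (by omega) hf0
    · rcases hfi i hi0 hi with ⟨l, -, hl, h⟩ | ⟨l, hl, h⟩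
      · exact hx l hl h
      · rcases hkm.eq_or_lt with rfl | hkm
        · rw [hgm]
          exact hG.not_adj_gridGadget_x (by omega) (Nat.lt_succ_self j) hj h
        · exact hG.not_adj_gridGadget hl hj hj.le hj h (hgi' k hk hkm)
  · simpa [appendSeq] using hf0
  · rw [appendSeq, if_neg (by omega), Nat.add_sub_cancel_left, hgm]
  · intro i hi him
    unfold appendSeq
    split_ifs with hiL
    · rcases hiL.eq_or_lt with rfl | hiL
      · exact Or.inl ⟨j, by omega, by omega, hfL⟩
      · rcases hfi i hi hiL with ⟨l, hl0, hl, h⟩ | ⟨l, hl, h⟩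
        · exact Or.inl ⟨l, hl0, by omega, h⟩
        · exact Or.inr ⟨l, by omega, gridGadget_mono (Nat.le_succ j) h⟩
    · exact Or.inr ⟨j, by omega, hgi' (i - L) (by omega) (by omega)⟩

theorem gridPath_add_four (hG : IsGrid G T x p q y y') {j L : ℕ} (hj : j < T)
    (h : GridPath G x p q y y' j L) : GridPath G x p q y y' (j + 1) (L + 4) := by
  have hxx := hG.xx
  have hxp := hG.xp
  have hxy := hG.xy
  have hpy := hG.py
  have hyy := hG.yy
  refine hG.gridPath_succ hj h (m := 4) (g := fun i => match i with
    | 0 => x j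
    | 1 => y j j
    | 2 => p j
    | 3 => y j (j + 1)
    | _ => x (j + 1)) (by omega) ?_ rfl rfl ?_ ?_
  · intro a b hab hb
    have h1 := hG.py j hj j hj.le
    have h2 := hG.py j hj (j + 1) hj
    interval_cases b <;> interval_cases a <;>
      simp [hxx, hxp, hxy, hpy, hyy, G.adj_comm _ (x _), G.adj_comm _ (p j), hj,
        hj.le]
  · intro i hi him
    interval_cases i <;> simp
  · intro i hi him k hk
    have := hk.trans hj
    interval_cases i <;> simp [hxx, hxp, hxy, hj, hj.le, this.le] <;> omega

theorem gridPath_add_three_or_five (hG : IsGrid G T x p q y y') {j : ℕ} (hj : j < T) :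
    (∀ L, GridPath G x p q y y' j L → GridPath G x p q y y' (j + 1) (L + 3)) ∨
      ∀ L, GridPath G x p q y y' j L → GridPath G x p q y y' (j + 1) (L + 5) := by
  have hxx := hG.xx
  have hxp := hG.xp
  have hxq := hG.xq
  have hxy := hG.xy
  have hxy' := hG.xy'
  have hpq := hG.pq j hj
  have hpy := hG.py j hj j hj.le
  have hqy := hG.qy j hj j hj.le
  have hpy' := hG.py' j hj (j + 1) hj
  have hqy' := hG.qy' j hj (j + 1) hj
  by_cases hyy : G.Adj (y j j) (y' j (j + 1))
  · refine Or.inl fun L h => hG.gridPath_succ hj h (m := 3) (g := fun i => match i with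
      | 0 => x j
      | 1 => y j j
      | 2 => y' j (j + 1)
      | _ => x (j + 1)) (by omega) ?_ rfl rfl ?_ ?_
    · intro a b hab hb
      interval_cases b <;> interval_cases a <;>
        simp [hxx, hxy, hxy', hyy, G.adj_comm _ (x _), hj, hj.le]
    · intro i hi him
      interval_cases i <;> simp
    · intro i hi him k hk
      have := hk.trans hj
      interval_cases i <;> simp [hxx, hxy, hxy', hj, hj.le, this.le] <;> omega
  · refine Or.inr fun L h => hG.gridPath_succ hj h (m := 5) (g := fun i => match i with
      | 0 => x j
      | 1 => y j j
      | 2 => p j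
      | 3 => q j
      | 4 => y' j (j + 1)
      | _ => x (j + 1)) (by omega) ?_ rfl rfl ?_ ?_
    · intro a b hab hb
      interval_cases b <;> interval_cases a <;>
        simp [hxx, hxp, hxq, hxy, hxy', hyy, hpq, hpy, hqy, hpy', hqy', G.adj_comm _ (x _),
          G.adj_comm (y j j) (p j), G.adj_comm (y j j) (q j), hj, hj.le]
    · intro i hi him
      interval_cases i <;> simp
    · intro i hi him k hk
      have := hk.trans hj
      interval_cases i <;> simp [hxx, hxp, hxq, hxy, hxy', hj, hj.le, this.le] <;> omega

theorem exists_gridPath_ranges (hG : IsGrid G T x p q y y') {j : ℕ} (hj : j ≤ T) :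
    ∃ a b, a + b = j ∧ (∀ r ≤ a, GridPath G x p q y y' j (4 * j + r)) ∧
      ∀ r ≤ b, GridPath G x p q y y' j (4 * j - r) := by
  induction j with
  | zero =>
    have h0 : GridPath G x p q y y' 0 0 :=
      ⟨fun _ => x 0, fun i j hij hj => absurd hij (by omega), rfl, rfl,
        fun i hi hi' => absurd hi (by omega)⟩
    exact ⟨0, 0, rfl, fun r hr => by rwa [Nat.le_zero.1 hr],
      fun r hr => by rwa [Nat.le_zero.1 hr]⟩
  | succ j ih =>
    obtain ⟨a, b, hab, ha, hb⟩ := ih (by omega)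
    have hup : ∀ r ≤ a, GridPath G x p q y y' (j + 1) (4 * (j + 1) + r) := by
      intro r hr
      convert hG.gridPath_add_four hj (ha r hr) using 1
      omega
    have hdown : ∀ r ≤ b, GridPath G x p q y y' (j + 1) (4 * (j + 1) - r) := by
      intro r hr
      convert hG.gridPath_add_four hj (hb r hr) using 1
      omega
    rcases hG.gridPath_add_three_or_five hj with h | h
    · refine ⟨a, b + 1, by omega, hup, fun r hr => ?_⟩
      rcases hr.lt_or_eq with hr | rfl
      · exact hdown r (by omega)
      · convert h _ (hb b le_rfl) using 1
        omega
    · refine ⟨a + 1, b, by omega, fun r hr => ?_, hdown⟩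
      rcases hr.lt_or_eq with hr | rfl
      · exact hup r (by omega)
      · convert h _ (ha a le_rfl) using 1
        omega

theorem gridPath_add_four_mul (hG : IsGrid G T x p q y y') {j L : ℕ}
    (h : GridPath G x p q y y' j L) (s : ℕ) (hs : j + s ≤ T) :
    GridPath G x p q y y' (j + s) (L + 4 * s) := by
  induction s with
  | zero => exact h
  | succ s ih => exact hG.gridPath_add_four hs (ih (by omega))

theorem exists_gridPath {L : ℕ} (hG : IsGrid G T x p q y y') (hL : 20 ≤ L) (hT : L ≤ T) :
    ∃ j, 0 < j ∧ j ≤ L ∧ GridPath G x p q y y' j L := by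
  obtain ⟨a, b, hab, ha, hb⟩ := hG.exists_gridPath_ranges (j := 5) (by omega)
  rcases Nat.lt_or_ge 2 a with h | h
  · refine ⟨5 + (L - 20) / 4, by omega, by omega, ?_⟩
    convert hG.gridPath_add_four_mul (ha ((L - 20) % 4) (by omega)) ((L - 20) / 4) (by omega)
      using 1
    omega
  · refine ⟨5 + (L - 17) / 4, by omega, by omega, ?_⟩
    convert hG.gridPath_add_four_mul (hb (3 - (L - 17) % 4) (by omega)) ((L - 17) / 4) (by omega)
      using 1
    omega

theorem nonempty_cycleGraph_embedding {ℓ : ℕ} (hG : IsGrid G T x p q y y') (hℓ : 24 ≤ ℓ)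
    (hT : ℓ ≤ T) : Nonempty (cycleGraph ℓ ↪g G) := by
  obtain ⟨j, hj0, hjL, f, hf, hf0, hfL, hfi⟩ :=
    hG.exists_gridPath (L := ℓ - 4) (by omega) (by omega)
  have hj : j < T := by omega
  have hℓ' : ℓ = (ℓ - 4) + 4 := by omega
  have hxx := hG.xx
  have hxp := hG.xp
  have hxy := hG.xy
  have hpj := hG.py j hj j hj.le
  have hp0 := hG.py j hj 0 (Nat.zero_le T)
  have hyy := hG.yy
  rw [hℓ']
  refine hf.nonempty_cycleGraph_embedding (m := 4) (g := fun i => match i with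
    | 0 => x j
    | 1 => y j j
    | 2 => p j
    | 3 => y j 0
    | _ => x 0) ?_ hfL hf0.symm (by omega) (by omega) (by omega) ?_
  · intro a b hab hb
    interval_cases b <;> interval_cases a <;>
      simp [hxx, hxp, hxy, hpj, hp0, hyy, G.adj_comm _ (x _), G.adj_comm _ (p j), hj, hj.le,
        hj0.ne, hj0.ne']
  · intro i hi hin k hk hkm
    rcases hfi i hi hin with ⟨l, hl0, hl, h⟩ | ⟨l, hl, h⟩
    · have := hl.trans hj
      rw [h]
      interval_cases k <;> simp [hxp, hxy, hj, hj.le, this.le] <;> omega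
    · refine hG.not_adj_gridGadget hl hj hj.le hj.le h ?_
      interval_cases k
      exacts [Or.inr (Or.inr ⟨j, le_rfl, Or.inl rfl⟩), Or.inl rfl,
        Or.inr (Or.inr ⟨0, Nat.zero_le j, Or.inl rfl⟩)]

end IsGrid

theorem IsMulticover.mono {G : SimpleGraph V} {X Y : Finset V} {N B : V → Set V} {C D : Set V}
    (h : IsMulticover G X N C) (hY : Y ⊆ X) (hB : ∀ x ∈ Y, B x ⊆ N x) (hD : D ⊆ C)
    (hdom : ∀ x ∈ Y, Dominates G (B x) D) : IsMulticover G Y B D := by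
  obtain ⟨hX, hcov, hdisj⟩ := h
  refine ⟨fun u hu v hv => hX u (hY hu) v (hY hv), fun x hx => ?_, fun x hx z hz hxz => ?_⟩
  · obtain ⟨h1, h2, h3, h4⟩ := hcov x (hY hx)
    exact ⟨fun u hu => h1 u (hB x hx hu), fun h => h2 (hD h), fun u hu => h3 u (hD hu),
      h4.1.mono (hB x hx) hD, hdom x hx⟩
  · obtain ⟨h1, h2⟩ := hdisj x (hY hx) z (hY hz) hxz
    exact ⟨fun h => h1 (hB x hx h), fun u hu => h2 u (hB x hx hu)⟩

theorem IsLinkage.exists_isGrid {G : SimpleGraph V} {X : Finset V} {N : V → Set V} {C : Set V}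
    {t : ℕ} {p q : ℕ → V} {y y' : ℕ → V → V} (h : IsLinkage G X N C t p q y y')
    (hN : IsMulticover G X N C) (hX : X.card = t + 1) : ∃ x y y', IsGrid G t x p q y y' := by
  obtain ⟨hstable, hcov, hdisj⟩ := hN
  let e := X.equivFinOfCardEq hX
  let x : ℕ → V := fun i => e.symm (Fin.ofNat (t + 1) i)
  have hxX : ∀ i, x i ∈ X := fun i => (e.symm (Fin.ofNat (t + 1) i)).2
  have hinj : ∀ i ≤ t, ∀ j ≤ t, x i = x j → i = j := by
    intro i hi j hj hij
    have h' := congrArg Fin.val (e.symm.injective (Subtype.ext hij))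
    rwa [Fin.val_ofNat, Fin.val_ofNat, Nat.mod_eq_of_lt (by omega),
      Nat.mod_eq_of_lt (by omega)] at h'
  have hadj : ∀ i ≤ t, ∀ k ≤ t, ∀ u ∈ N (x k), (G.Adj (x i) u ↔ i = k) := by
    intro i hi k hk u hu
    constructor
    · intro hxu
      by_contra hik
      exact (hdisj (x k) (hxX k) (x i) (hxX i) fun h => hik (hinj k hk i hi h).symm).2 u hu hxu
    · rintro rfl
      exact (hcov _ (hxX i)).1 u hu
  refine ⟨x, fun j k => y j (x k), fun j k => y' j (x k), ?_⟩
  exact {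
    xx := fun i _ j _ => hstable _ (hxX i) _ (hxX j)
    xp := fun i _ j hj => (hcov _ (hxX i)).2.2.1 _ (h.mem_p j hj)
    xq := fun i _ j hj => (hcov _ (hxX i)).2.2.1 _ (h.mem_q j hj)
    xy := fun i hi j hj k hk => hadj i hi k hk _ ((h.isGadget j hj).mem _ (hxX k))
    xy' := fun i hi j hj k hk => hadj i hi k hk _ ((h.isGadget j hj).mem' _ (hxX k))
    pq := fun j hj => (h.isGadget j hj).adj
    py := fun j hj k _ => (h.isGadget j hj).adj_p _ (hxX k)
    py' := fun j hj k _ => (h.isGadget j hj).not_adj_p' _ (hxX k)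
    qy := fun j hj k _ => (h.isGadget j hj).not_adj_q _ (hxX k)
    qy' := fun j hj k _ => (h.isGadget j hj).adj_q' _ (hxX k)
    yy := fun j hj k _ l _ => (h.isGadget j hj).indep _ (hxX k) _ (hxX l)
    sep := by
      have hverts : ∀ (i : ℕ) (u : V),
          (u = p i ∨ u = q i ∨ ∃ k ≤ t, u = y i (x k) ∨ u = y' i (x k)) →
            u ∈ gadgetVerts X (p i) (q i) (y i) (y' i) := by
        rintro i u (hu | hu | ⟨k, -, hu⟩)
        exacts [Or.inl hu, Or.inr (Or.inl hu), Or.inr (Or.inr ⟨x k, hxX k, hu⟩)]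
      exact fun i j hij hj u v hu hv =>
        h.anticomplete i j hij hj u (hverts i u hu) v (hverts j v hv) }

theorem exists_isNClique_of_not_cliqueNum_lt [Finite V] {G : SimpleGraph V} {S : Set V} {n : ℕ}
    (h : ¬ (G.induce S).cliqueNum < n) : ∃ K : Finset V, ↑K ⊆ S ∧ G.IsNClique n K := by
  classical
  have := Fintype.ofFinite V
  obtain ⟨s, hs⟩ := (G.induce S).exists_isNClique_cliqueNum
  obtain ⟨t, hts, htn⟩ := Finset.exists_subset_card_eq (s := s) (n := n) (by
    rw [hs.card_eq]; omega)
  refine ⟨t.map (Function.Embedding.subtype _), ?_, ?_⟩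
  · intro v hv
    obtain ⟨w, -, rfl⟩ := Finset.mem_map.1 (Finset.mem_coe.1 hv)
    exact w.2
  · refine ⟨?_, by rw [Finset.card_map, htn]⟩
    intro u hu v hv huv
    obtain ⟨a, ha, rfl⟩ := Finset.mem_map.1 (Finset.mem_coe.1 hu)
    obtain ⟨b, hb, rfl⟩ := Finset.mem_map.1 (Finset.mem_coe.1 hv)
    exact hs.isClique (hts ha) (hts hb) fun h => huv (h ▸ rfl)

theorem isCliqueControlled [Finite V] {G : SimpleGraph V} {κ τ : ℕ} (hω : G.cliqueNum ≤ κ)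
    (hχ : ∀ Y : Set V, (G.induce Y).cliqueNum < κ → (G.induce Y).chromaticNumber ≤ (τ : ℕ∞)) :
    IsCliqueControlled G κ τ := by
  classical
  have := Fintype.ofFinite V
  have hfree : G.CliqueFree (κ + 1) := fun K hK => by
    have := hK.isClique.card_le_cliqueNum
    rw [hK.card_eq] at this
    omega
  have hclique : ∀ D, ¬ ColorableOn G D τ → ∃ K : Finset V, ↑K ⊆ D ∧ G.IsNClique κ K := by
    intro D hD
    rw [not_colorableOn_iff_lt_chromaticNumber] at hD
    exact exists_isNClique_of_not_cliqueNum_lt fun h => absurd (hχ D h) (not_le.2 hD)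
  refine ⟨hfree, fun v => ?_, hclique⟩
  by_contra hv
  obtain ⟨K, hKv, hK⟩ := hclique _ hv
  exact hfree _ (hK.insert fun b hb => hKv hb)

theorem stmt11 (ℓ : ℕ) (hℓ : 24 ≤ ℓ) (τ κ : ℕ) :
    ∃ m c : ℕ, ∀ (V : Type) [Fintype V] (G : SimpleGraph V)
      (X : Finset V) (N : V → Set V) (C : Set V),
      G.cliqueNum ≤ κ →
      (∀ Y : Set V, (G.induce Y).cliqueNum < κ →
        (G.induce Y).chromaticNumber ≤ (τ : ℕ∞)) →
      IsMulticover G X N C → X.card = m →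
      (c : ℕ∞) < (G.induce C).chromaticNumber →
      (4 ≤ ℓ ∧ Nonempty (cycleGraph ℓ ↪g G)) := by
  obtain ⟨m, b, -, h⟩ := exists_isLinkage κ τ (ℓ + 1) (Nat.succ_pos ℓ) ℓ
  refine ⟨m, (τ + 1) ^ m * b, fun V _ G X N C hω hχ hN hX hC => ⟨by omega, ?_⟩⟩
  have hG := isCliqueControlled hω hχ
  rw [← not_colorableOn_iff_lt_chromaticNumber] at hC
  obtain ⟨col, hcol⟩ := exists_neighborSet_coloring hG.neighborSet_colorableOn
  obtain ⟨g, D, hD, hDc, hg⟩ := exists_refinement (X := X) (N := N) (C := C) (c := b) col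
    (fun x hx => (hN.2.1 x hx).2.2.2.2) (by simpa [hX] using hC)
  let B : V → Set V := fun x => {u | u ∈ N x ∧ col x u = g x}
  have hB : IsMulticover G X B D := hN.mono subset_rfl (fun x _ u hu => hu.1) hD
    fun x hx v hv => by
      obtain ⟨u, hu, hug, huv⟩ := hg x hx v hv
      exact ⟨u, ⟨hu, hug⟩, huv⟩
  obtain ⟨Y, hY, hYc, p, q, y, y', hl⟩ := h V G hG X B D hX
    (fun x hx => (hB.2.1 x hx).2.2.2.2)
    (fun x hx u hu v hv huv => hcol x u v ((hN.2.1 x hx).1 u hu.1) ((hN.2.1 x hx).1 v hv.1) huv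
      (hu.2.trans hv.2.symm)) hDc
  obtain ⟨x, y, y', hgrid⟩ := hl.exists_isGrid (hB.mono hY (fun _ _ => subset_rfl) subset_rfl
    fun x hx => (hB.2.1 x (hY hx)).2.2.2.2) hYc
  exact hgrid.nonempty_cycleGraph_embedding hℓ le_rfl
end

section
/- Let G be a graph and let B, C ⊆ V(G), where B covers C. Suppose every induced subgraph J of G with ω(J) < ω(G) has chromatic number at most τ. Let the enumeration (b_1, …, b_m) of B and the grading (W_1, …, W_n) of G[C] be compatible, with (W_1, …, W_n) τ-colourable, and let χ(G[C]) > τ²(2c + 3τ). Then there is a square edge uv of G[C] and a subset X of V(G) such that: G[X] is connected; u and v are both earlier than every vertex of X; v has a neighbour in X and u does not; and χ(G[X]) > c. -/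
open SimpleGraph

variable {V : Type*}

/-- `W` is a grading of the set `U`: pairwise disjoint sets with union `U`. -/
def IsGrading (U : Set V) {n : ℕ} (W : Fin n → Set V) : Prop :=
  (⋃ i, W i) = U ∧ ∀ i j, i ≠ j → Disjoint (W i) (W j)

/-- `u` is earlier than `v` with respect to the grading `W`. -/
def Earlier {n : ℕ} (W : Fin n → Set V) (u v : V) : Prop :=
  ∃ i j, i < j ∧ u ∈ W i ∧ v ∈ W j

/-- `b i` is the earliest parent of `v` w.r.t. the enumeration `b`. -/
def EarliestParent (G : SimpleGraph V) {m : ℕ} (b : Fin m → V) (v : V) (i : Fin m) : Prop :=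
  G.Adj (b i) v ∧ ∀ j, j < i → ¬ G.Adj (b j) v

/-- `uv` is a square edge w.r.t. the enumeration `b`. -/
def SquareEdge (G : SimpleGraph V) {m : ℕ} (b : Fin m → V) (u v : V) : Prop :=
  G.Adj u v ∧ ∀ i j, EarliestParent G b u i → EarliestParent G b v j →
    ¬ G.Adj (b i) v ∧ ¬ G.Adj (b j) u

/-- The enumeration `b` of `B` and the grading `W` of `C` are compatible. -/
def CompatibleEnum (G : SimpleGraph V) {m n : ℕ} (b : Fin m → V) (W : Fin n → Set V)
    (C : Set V) : Prop :=
  ∀ u ∈ C, ∀ v ∈ C, Earlier W u v →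
    ∀ i j, EarliestParent G b u i → EarliestParent G b v j → i < j

/-- Inducing twice is inducing on the image. -/
noncomputable def induceInduceIso (G : SimpleGraph V) (S : Set V) (T : Set S) :
    (G.induce S).induce T ≃g G.induce (Subtype.val '' T) where
  toEquiv := Equiv.Set.image Subtype.val T Subtype.val_injective
  map_rel_iff' := by simp

lemma SimpleGraph.Colorable.induce_mono {G : SimpleGraph V} {A B : Set V} {k : ℕ}
    (hB : (G.induce B).Colorable k) (h : A ⊆ B) : (G.induce A).Colorable k :=
  hB.of_hom (SimpleGraph.induceHomOfLE G h).toHom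

lemma SimpleGraph.Colorable.induce_union {G : SimpleGraph V} {A B : Set V} {k l : ℕ}
    (hA : (G.induce A).Colorable k) (hB : (G.induce B).Colorable l) :
    (G.induce (A ∪ B)).Colorable (k + l) := by
  classical
  obtain ⟨f⟩ := hA
  obtain ⟨g⟩ := hB
  let F : (A ∪ B : Set V) → Fin k ⊕ Fin l := fun x =>
    if h : x.1 ∈ A then .inl (f ⟨x, h⟩) else .inr (g ⟨x, x.2.resolve_left h⟩)
  have hF : ∀ {x y : (A ∪ B : Set V)}, (G.induce (A ∪ B)).Adj x y → F x ≠ F y := by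
    intro x y hxy
    simp only [F]
    split_ifs with hx hy
    · simpa using f.valid (v := ⟨x, hx⟩) (w := ⟨y, hy⟩) hxy
    · simp
    · simp
    · simpa using g.valid (v := ⟨x, x.2.resolve_left hx⟩)
        (w := ⟨y, y.2.resolve_left (by assumption)⟩) hxy
  simpa using (Coloring.mk F hF).colorable

lemma SimpleGraph.Colorable.induce_subset_union {G : SimpleGraph V} {A B D : Set V} {k l : ℕ}
    (hD : D ⊆ A ∪ B) (hA : (G.induce A).Colorable k) (hB : (G.induce B).Colorable l) :
    (G.induce D).Colorable (k + l) :=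
  (hA.induce_union hB).induce_mono hD

/-- A set that is not `k`-colourable contains a connected component that is not `k`-colourable. -/
lemma exists_component_not_colorable {G : SimpleGraph V} {S : Set V} {k : ℕ}
    (h : ¬ (G.induce S).Colorable k) :
    ∃ K ⊆ S, (G.induce K).Connected ∧ ¬ (G.induce K).Colorable k ∧
      ∀ x ∈ K, ∀ y ∈ S, G.Adj x y → y ∈ K := by
  rw [colorable_iff_forall_connectedComponent] at h
  push Not at h
  obtain ⟨D, hD⟩ := h
  refine ⟨Subtype.val '' D.supp, by simp, ?_, ?_, ?_⟩
  · exact (induceInduceIso G S D.supp).connected_iff.1 D.connected_toSimpleGraph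
  · exact fun hc => hD (hc.of_hom (induceInduceIso G S D.supp).toHom)
  · rintro _ ⟨x, hx, rfl⟩ y hy hxy
    exact ⟨⟨y, hy⟩, D.mem_supp_of_adj_mem_supp hx hxy, rfl⟩

/-- A property that spreads along edges of a connected set holds on all of it. -/
lemma SimpleGraph.Connected.forall_of_adj {G : SimpleGraph V} {K : Set V} (hK : (G.induce K).Connected)
    {P : V → Prop} {a : V} (ha : a ∈ K) (hPa : P a)
    (hP : ∀ x ∈ K, ∀ y ∈ K, G.Adj x y → P x → P y) : ∀ x ∈ K, P x := by
  intro x hx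
  obtain ⟨p⟩ := hK.preconnected ⟨a, ha⟩ ⟨x, hx⟩
  suffices ∀ (y z : K), (G.induce K).Walk y z → P y → P z from this _ _ p hPa
  intro y z q
  induction q with
  | nil => exact id
  | cons hadj _ ih => exact fun h => ih (hP _ (Subtype.coe_prop _) _ (Subtype.coe_prop _) hadj h)

lemma nonempty_of_not_colorable {G : SimpleGraph V} {S : Set V} {k : ℕ}
    (h : ¬ (G.induce S).Colorable k) : S.Nonempty := by
  by_contra hS
  rw [Set.not_nonempty_iff_eq_empty] at hS
  subst hS
  exact h (Colorable.of_isEmpty k)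

/-- If every vertex with a neighbour in a later connected set of large chromatic number is
excluded from `S`, then the chromatic number of `S` is bounded. -/
lemma colorable_of_forall_not_adj_later [Finite V] {G : SimpleGraph V} {S : Set V} {g : V → ℕ}
    {k τ : ℕ} (hlevel : ∀ i, (G.induce {v ∈ S | g v = i}).Colorable τ)
    (hS : ∀ v ∈ S, ∀ X ⊆ S, (G.induce X).Connected → (∀ w ∈ X, g v < g w) →
      ¬ (G.induce X).Colorable k → ∀ w ∈ X, ¬ G.Adj v w) :
    (G.induce S).Colorable (k + τ) := by
  classical
  by_contra hcon
  obtain ⟨K, hKS, hKconn, hKcol, -⟩ := exists_component_not_colorable hcon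
  obtain ⟨N, hN⟩ := (Set.toFinite (g '' K)).bddAbove
  have hex : ∃ i, (G.induce {v ∈ K | i ≤ g v}).Colorable k := by
    refine ⟨N + 1, ?_⟩
    have : {v ∈ K | N + 1 ≤ g v} = ∅ := by
      ext v
      simp only [Set.mem_ofPred_eq, Set.mem_empty_iff_false, iff_false, not_and, not_le]
      exact fun hv => Nat.lt_succ_of_le (hN ⟨v, hv, rfl⟩)
    rw [this]
    exact Colorable.of_isEmpty k
  obtain ⟨i, hi, hmin⟩ : ∃ i, (G.induce {v ∈ K | i ≤ g v}).Colorable k ∧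
      ∀ j < i, ¬ (G.induce {v ∈ K | j ≤ g v}).Colorable k :=
    ⟨Nat.find hex, Nat.find_spec hex, fun j hj => Nat.find_min hex hj⟩
  cases i with
  | zero => exact hKcol ((hi.induce_mono (fun v hv => ⟨hv, Nat.zero_le _⟩)).mono (by omega))
  | succ j =>
    obtain ⟨X, hXK, hXconn, hXcol, hXclosed⟩ :=
      exists_component_not_colorable (hmin j (Nat.lt_succ_self j))
    obtain ⟨a, ha⟩ := nonempty_of_not_colorable hXcol
    have hall : ∀ x ∈ K, x ∈ X := by
      refine hKconn.forall_of_adj (hXK ha).1 ha fun x hx y hy hxy hxX => ?_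
      by_cases hgy : j ≤ g y
      · exact hXclosed x hxX y ⟨hy, hgy⟩ hxy
      · refine absurd hxy.symm (hS y (hKS hy) X (fun w hw => hKS (hXK hw).1) hXconn ?_ hXcol x hxX)
        exact fun w hw => (not_le.1 hgy).trans_le (hXK hw).2
    refine hKcol (hi.induce_subset_union (fun x hx => ?_) (hlevel j))
    have hjx := (hXK (hall x hx)).2
    rcases hjx.eq_or_lt with h | h
    · exact Or.inr ⟨hKS hx, h.symm⟩
    · exact Or.inl ⟨hx, h⟩

/-- If `H ≤ G` has large chromatic number on `C`, then some edge `uv` of `H` is separated by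
a connected set of large chromatic number in `G` that is later than both ends. -/
theorem exists_adj_connected_later [Finite V] {G H : SimpleGraph V} (hHG : H ≤ G) {C : Set V}
    {g : V → ℕ} {c τ : ℕ} (hnbr : ∀ v, (G.induce (G.neighborSet v)).Colorable τ)
    (hlevel : ∀ i, (G.induce {v ∈ C | g v = i}).Colorable τ)
    (hH : ¬ (H.induce C).Colorable (c + 3 * τ)) :
    ∃ u ∈ C, ∃ v ∈ C, H.Adj u v ∧ ∃ X ⊆ C, (G.induce X).Connected ∧
      (∀ w ∈ X, g u < g w ∧ g v < g w) ∧ (∃ w ∈ X, G.Adj v w) ∧ (∀ w ∈ X, ¬ G.Adj u w) ∧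
      ¬ (G.induce X).Colorable c := by
  by_contra hcon
  have hspread : ∀ v ∈ C, ∀ u ∈ C, H.Adj v u → ∀ X ⊆ C, (G.induce X).Connected →
      (∀ w ∈ X, g u < g w ∧ g v < g w) → ¬ (G.induce X).Colorable c →
      (∃ w ∈ X, G.Adj v w) → ∃ w ∈ X, G.Adj u w := by
    intro v hv u hu hvu X hX hXconn hXlater hXcol hvX
    by_contra! hne
    exact hcon ⟨u, hu, v, hv, hvu.symm, X, hX, hXconn, hXlater, hvX, hne, hXcol⟩
  let active : V → Prop := fun v => ∃ X ⊆ C, (G.induce X).Connected ∧ (∀ w ∈ X, g v < g w) ∧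
    ¬ (G.induce X).Colorable (c + τ) ∧ ∃ w ∈ X, G.Adj v w
  have hinactive : (G.induce {v ∈ C | ¬ active v}).Colorable (c + τ + τ) := by
    refine colorable_of_forall_not_adj_later (g := g)
      (fun i => (hlevel i).induce_mono fun v hv => ⟨hv.1.1, hv.2⟩) ?_
    intro v hv X hX hXconn hXlater hXcol w hw hvw
    exact hv.2 ⟨X, fun x hx => (hX hx).1, hXconn, hXlater, hXcol, w, hw, hvw⟩
  have hactive : (H.induce {v ∈ C | active v}).Colorable τ := by
    by_contra hR
    obtain ⟨K, hKR, hKconn, hKcol, -⟩ := exists_component_not_colorable hR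
    obtain ⟨v, hvK, hvmax⟩ := Set.exists_max_image K g (Set.toFinite K)
      (nonempty_of_not_colorable hKcol)
    obtain ⟨Y, hYC, hYconn, hYlater, hYcol, y, hyY, hvy⟩ := (hKR hvK).2
    have hlater : ∀ u ∈ K, ∀ w ∈ Y, g u < g w := fun u hu w hw =>
      (hvmax u hu).trans_lt (hYlater w hw)
    have hall : ∀ X ⊆ Y, (G.induce X).Connected → ¬ (G.induce X).Colorable c → ∀ u ∈ K,
        (∃ w ∈ X, G.Adj u w) → ∀ u' ∈ K, ∃ w ∈ X, G.Adj u' w := by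
      intro X hX hXconn hXcol u hu huX
      refine hKconn.forall_of_adj hu huX fun p hp q hq hpq hpX => ?_
      exact hspread p (hKR hp).1 q (hKR hq).1 hpq X (hX.trans hYC) hXconn
        (fun w hw => ⟨hlater q hq w (hX hw), hlater p hp w (hX hw)⟩) hXcol hpX
    have hdel : ¬ (G.induce (Y \ G.neighborSet v)).Colorable c := fun h =>
      hYcol (h.induce_subset_union (fun x hx => by by_cases hx' : x ∈ G.neighborSet v <;> simp_all)
        (hnbr v))
    obtain ⟨X₀, hX₀, hX₀conn, hX₀col, -⟩ := exists_component_not_colorable hdel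
    have hX₀K : ∀ u ∈ K, ∀ w ∈ X₀, ¬ G.Adj u w := by
      intro u hu w hw huw
      obtain ⟨x, hx, hvx⟩ := hall X₀ (fun x hx => (hX₀ hx).1) hX₀conn hX₀col u hu ⟨w, hw, huw⟩ v hvK
      exact (hX₀ hx).2 hvx
    have hZcol : ¬ (G.induce {x ∈ Y | ∀ u ∈ K, ¬ G.Adj u x}).Colorable c := fun h =>
      hX₀col (h.induce_mono fun x hx => ⟨(hX₀ hx).1, fun u hu => hX₀K u hu x hx⟩)
    obtain ⟨X, hXZ, hXconn, hXcol, hXclosed⟩ := exists_component_not_colorable hZcol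
    obtain ⟨a, ha⟩ := nonempty_of_not_colorable hXcol
    obtain ⟨x, hx, z, hz, hxz, hxX, hzX⟩ :
        ∃ x ∈ Y, ∃ z ∈ Y, G.Adj x z ∧ x ∈ X ∧ z ∉ X := by
      by_contra! hno
      have := hYconn.forall_of_adj (P := (· ∈ X)) (hXZ ha).1 ha hno y hyY
      exact (hXZ this).2 v hvK hvy
    obtain ⟨u, hu, huz⟩ : ∃ u ∈ K, G.Adj u z := by
      by_contra! hno
      exact hzX (hXclosed x hxX z ⟨hz, hno⟩ hxz)
    have hconn : (G.induce (X ∪ {x, z})).Connected :=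
      induce_union_connected hXconn.preconnected
        (induce_pair_connected_of_adj hxz).preconnected ⟨x, hxX, by simp⟩
    have hKz : ∀ u' ∈ K, G.Adj z u' := by
      intro u' hu'
      obtain ⟨w, hw, huw⟩ := hall (X ∪ {x, z})
        (Set.union_subset (fun w hw => (hXZ hw).1) (by simp [Set.insert_subset_iff, hx, hz])) hconn
        (fun h => hXcol (h.induce_mono Set.subset_union_left)) u hu ⟨z, by simp, huz⟩ u' hu'
      rcases hw with hw | rfl | rfl
      · exact absurd huw ((hXZ hw).2 u' hu')
      · exact absurd huw ((hXZ hxX).2 u' hu')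
      · exact huw.symm
    exact hKcol (((hnbr z).induce_mono hKz).mono_left (comap_monotone _ hHG))
  refine hH (((hinactive.mono_left (comap_monotone _ hHG)).induce_subset_union
    (fun v hv => ?_) hactive).mono (by omega))
  by_cases h : active v
  · exact Or.inr ⟨hv, h⟩
  · exact Or.inl ⟨hv, h⟩

/-- If `H` is `k`-colourable on `C` and `G` is `l`-colourable on each `H`-independent subset
of `C`, then `G` is `k * l`-colourable on `C`. -/
lemma SimpleGraph.Colorable.induce_mul {G H : SimpleGraph V} {C : Set V} {k l : ℕ}
    (hH : (H.induce C).Colorable k)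
    (hG : ∀ D ⊆ C, (∀ u ∈ D, ∀ v ∈ D, ¬ H.Adj u v) → (G.induce D).Colorable l) :
    (G.induce C).Colorable (k * l) := by
  obtain ⟨f⟩ := hH
  have hcls : ∀ i : Fin k, Nonempty ((G.induce {v | ∃ h : v ∈ C, f ⟨v, h⟩ = i}).Coloring (Fin l)) :=
    fun i => hG _ (fun v hv => hv.1) fun u ⟨hu, hui⟩ v ⟨hv, hvi⟩ huv =>
      f.valid (v := ⟨u, hu⟩) (w := ⟨v, hv⟩) huv (hui.trans hvi.symm)
  let F := fun i => (hcls i).some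
  let E : C → Fin k × Fin l := fun x => (f x, F (f x) ⟨x, x.2, rfl⟩)
  have hE : ∀ {x y : C}, (G.induce C).Adj x y → E x ≠ E y := by
    intro x y hxy hEq
    obtain ⟨h1, h2⟩ := Prod.ext_iff.1 hEq
    have key : ∀ i (hi : f y = i), F i ⟨y, y.2, hi⟩ = F (f y) ⟨y, y.2, rfl⟩ := by
      rintro _ rfl
      rfl
    refine (F (f x)).valid (v := ⟨x, x.2, rfl⟩) (w := ⟨y, y.2, h1.symm⟩) hxy ?_
    exact h2.trans (key _ h1.symm).symm
  simpa using (Coloring.mk E hE).colorable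

/-- If every nonempty clique inside `D` extends by a common neighbour, then `D` has smaller
clique number than the whole graph. -/
lemma cliqueNum_induce_lt [Finite V] [Nonempty V] {G : SimpleGraph V} {D : Set V}
    (h : ∀ t : Finset V, t.Nonempty → ↑t ⊆ D → G.IsClique t → ∃ a, ∀ x ∈ t, G.Adj a x) :
    (G.induce D).cliqueNum < G.cliqueNum := by
  classical
  obtain ⟨s, hs⟩ := (G.induce D).exists_isNClique_cliqueNum
  have ht : G.IsNClique (G.induce D).cliqueNum (s.map (Function.Embedding.subtype (· ∈ D))) :=
    (hs.map (f := Function.Embedding.subtype (· ∈ D))).mono (map_comap_le _ _)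
  have hex : ∃ a, ∀ x ∈ s.map (Function.Embedding.subtype (· ∈ D)), G.Adj a x := by
    rcases s.eq_empty_or_nonempty with rfl | hne
    · exact ⟨Classical.arbitrary V, by simp⟩
    · exact h _ (by simpa using hne) (by intro x; simp +contextual) ht.isClique
  obtain ⟨a, ha⟩ := hex
  have hins := ht.insert ha
  exact Nat.lt_of_succ_le (hins.card_eq.symm.le.trans hins.isClique.card_le_cliqueNum)

/-- The graph of square edges. -/
def squareGraph (G : SimpleGraph V) {m : ℕ} (b : Fin m → V) : SimpleGraph V where
  Adj u v := SquareEdge G b u v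
  symm.symm _ _ h := ⟨h.1.symm, fun i j hi hj => (h.2 j i hj hi).symm⟩
  loopless.irrefl _ h := h.1.ne rfl

lemma exists_earliestParent {G : SimpleGraph V} {m : ℕ} {b : Fin m → V} {v : V}
    (h : ∃ i, G.Adj (b i) v) : ∃ i, EarliestParent G b v i := by
  classical
  exact ⟨Fin.find (fun i => G.Adj (b i) v) h, Fin.find_spec h, fun j hj => Fin.find_min h hj⟩

/-- Sets without square edges have smaller clique number. -/
lemma cliqueNum_induce_lt_of_not_squareEdge [Finite V] [Nonempty V] {G : SimpleGraph V} {m : ℕ}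
    {b : Fin m → V} {D : Set V} (hpar : ∀ v ∈ D, ∃ i, G.Adj (b i) v)
    (hD : ∀ u ∈ D, ∀ v ∈ D, ¬ SquareEdge G b u v) :
    (G.induce D).cliqueNum < G.cliqueNum := by
  refine cliqueNum_induce_lt fun t htne htD ht => ?_
  have hp : ∀ v : V, ∃ i : ℕ, v ∈ D → ∃ j : Fin m, j = i ∧ EarliestParent G b v j := by
    intro v
    by_cases hv : v ∈ D
    · obtain ⟨j, hj⟩ := exists_earliestParent (hpar v hv)
      exact ⟨j, fun _ => ⟨j, rfl, hj⟩⟩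
    · exact ⟨0, fun h => absurd h hv⟩
  choose p hp using hp
  obtain ⟨v, hvt, hvmax⟩ := t.exists_max_image p htne
  obtain ⟨j, hjv, hj⟩ := hp v (htD hvt)
  refine ⟨b j, fun u hut => ?_⟩
  by_cases huv : u = v
  · exact huv ▸ hj.1
  obtain ⟨i, hiu, hi⟩ := hp u (htD hut)
  have hij : i ≤ j := by
    rw [Fin.le_def, hiu, hjv]
    exact hvmax u hut
  rcases hij.eq_or_lt with rfl | hlt
  · exact hi.1
  by_contra hnadj
  refine hD u (htD hut) v (htD hvt) ⟨ht hut hvt huv, fun i' j' hi' hj' => ?_⟩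
  have huniq : ∀ {w a a'}, EarliestParent G b w a → EarliestParent G b w a' → a = a' :=
    fun h h' => le_antisymm (not_lt.1 fun hl => h.2 _ hl h'.1) (not_lt.1 fun hl => h'.2 _ hl h.1)
  rw [huniq hi' hi, huniq hj' hj]
  exact ⟨hj.2 i hlt, hnadj⟩

theorem stmt17 (τ c : ℕ) {V : Type*} [Fintype V] (G : SimpleGraph V)
    (hτ : ∀ Y : Set V, (G.induce Y).cliqueNum < G.cliqueNum →
      (G.induce Y).chromaticNumber ≤ (τ : ℕ∞))
    (m : ℕ) (b : Fin m → V) (hb : Function.Injective b) (C : Set V)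
    (hcov : Covers G (Set.range b) C)
    (n : ℕ) (W : Fin n → Set V) (hgrad : IsGrading C W)
    (hcompat : CompatibleEnum G b W C)
    (hcol : ∀ i, (G.induce (W i)).chromaticNumber ≤ (τ : ℕ∞))
    (hchiC : ((τ ^ 2 * (2 * c + 3 * τ) : ℕ) : ℕ∞) < (G.induce C).chromaticNumber) :
    ∃ u ∈ C, ∃ v ∈ C, SquareEdge G b u v ∧ ∃ X : Set V,
      (G.induce X).Connected ∧
      (∀ w ∈ X, Earlier W u w ∧ Earlier W v w) ∧
      (∃ w ∈ X, G.Adj v w) ∧ (∀ w ∈ X, ¬ G.Adj u w) ∧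
      (c : ℕ∞) < (G.induce X).chromaticNumber := by
  have hcolC : ¬ (G.induce C).Colorable (τ ^ 2 * (2 * c + 3 * τ)) := fun h =>
    (chromaticNumber_le_iff_colorable.2 h).not_gt hchiC
  obtain ⟨v₀, hv₀⟩ := nonempty_of_not_colorable hcolC
  have : Nonempty V := ⟨v₀⟩
  have hτ' : ∀ Y : Set V, (G.induce Y).cliqueNum < G.cliqueNum → (G.induce Y).Colorable τ :=
    fun Y hY => chromaticNumber_le_iff_colorable.1 (hτ Y hY)
  have hlev : ∀ v : V, ∃ k : ℕ, v ∈ C → ∃ i : Fin n, i = k ∧ v ∈ W i := by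
    intro v
    by_cases hv : v ∈ C
    · rw [← hgrad.1, Set.mem_iUnion] at hv
      obtain ⟨i, hi⟩ := hv
      exact ⟨i, fun _ => ⟨i, rfl, hi⟩⟩
    · exact ⟨0, fun h => absurd h hv⟩
  choose g hg using hlev
  have hearlier : ∀ u ∈ C, ∀ v ∈ C, g u < g v → Earlier W u v := by
    intro u hu v hv huv
    obtain ⟨i, hi, hui⟩ := hg u hu
    obtain ⟨j, hj, hvj⟩ := hg v hv
    exact ⟨i, j, by rw [Fin.lt_def]; omega, hui, hvj⟩
  have hτpos : 1 ≤ τ := by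
    by_contra h0
    obtain rfl : τ = 0 := by omega
    obtain ⟨i, -, hi⟩ := hg v₀ hv₀
    have := chromaticNumber_le_iff_colorable.1 (hcol i)
    rw [colorable_zero_iff] at this
    exact this.false ⟨v₀, hi⟩
  have hlevel : ∀ i, (G.induce {v ∈ C | g v = i}).Colorable τ := by
    intro i
    by_cases hin : i < n
    · refine (chromaticNumber_le_iff_colorable.1 (hcol ⟨i, hin⟩)).induce_mono (fun v hv => ?_)
      obtain ⟨j, hj, hvj⟩ := hg v hv.1
      rwa [show (⟨i, hin⟩ : Fin n) = j from Fin.ext (by rw [hj]; exact hv.2.symm)]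
    · refine Colorable.induce_mono (B := ∅) (Colorable.of_isEmpty τ) (fun v hv => ?_)
      obtain ⟨j, hj, -⟩ := hg v hv.1
      have := hv.2
      omega
  have hpar : ∀ v ∈ C, ∃ i, G.Adj (b i) v := by
    intro v hv
    obtain ⟨_, ⟨i, rfl⟩, hi⟩ := hcov.2 v hv
    exact ⟨i, hi⟩
  have hnbr : ∀ v, (G.induce (G.neighborSet v)).Colorable τ := fun v =>
    hτ' _ (cliqueNum_induce_lt fun t _ ht _ => ⟨v, fun x hx => ht hx⟩)
  have hsq : ¬ ((squareGraph G b).induce C).Colorable (c + 3 * τ) := by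
    intro h
    refine hcolC ((h.induce_mul fun D hDC hD => hτ' D
      (cliqueNum_induce_lt_of_not_squareEdge (fun v hv => hpar v (hDC hv)) hD)).mono ?_)
    nlinarith [Nat.mul_le_mul hτpos (le_refl (τ * (c + 3 * τ))), Nat.zero_le (τ ^ 2 * c)]
  obtain ⟨u, hu, v, hv, huv, X, hXC, hXconn, hXlater, hvX, huX, hXcol⟩ :=
    exists_adj_connected_later (H := squareGraph G b) (fun _ _ h => h.1) hnbr hlevel hsq
  refine ⟨u, hu, v, hv, huv, X, hXconn, fun w hw => ?_, hvX, huX, ?_⟩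
  · exact ⟨hearlier u hu w (hXC hw) (hXlater w hw).1, hearlier v hv w (hXC hw) (hXlater w hw).2⟩
  · exact not_le.1 fun h => hXcol (chromaticNumber_le_iff_colorable.1 h)
end
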